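/- arXiv:1404.4812 — 11 statements merged into one kernel-verified Lean document; each statement's English description precedes it below -/
import Mathlib

section
/- A joint distribution P on a finite directed acyclic graph G is a correlation if and only if for every maximal pair of subsets U, W ⊆ V with past(U) ∩ past(W) = ∅ — maximal meaning that for every node z ∈ V ∖ (U ∪ W) one has past(U ∪ {z}) ∩ past(W) ≠ ∅ and past(U) ∩ past(W ∪ {z}) ≠ ∅ — the marginal of P on U ∪ W equals the product of the marginal of P on U and the marginal of P on W. -/
/-- The causal past of a set of nodes `U` in a directed graph with edge relation `E`:
`U` itself together with all nodes from which some node of `U` is reachable by a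
nonempty directed path. -/
def past {V : Type} (E : V → V → Prop) (U : Set V) : Set V :=
  U ∪ {u | ∃ v ∈ U, Relation.TransGen E u v}

open Classical in
/-- The marginal of a joint distribution `P` on the set of nodes `U`, evaluated at the
outcome tuple `f` (only the values of `f` on `U` matter). -/
noncomputable def marginal {V : Type} [Fintype V] [DecidableEq V] {O : V → Type}
    [∀ v, Fintype (O v)] (P : ((v : V) → O v) → ℝ) (U : Set V)
    (f : (v : V) → O v) : ℝ :=
  ∑ o : (v : V) → O v, if ∀ v ∈ U, o v = f v then P o else 0

/-- `P` is a correlation: for every finite family of node sets with pairwise disjoint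
causal pasts, the marginal on the union factorizes into the product of the marginals. -/
def IsCorrelation {V : Type} [Fintype V] [DecidableEq V] {O : V → Type}
    [∀ v, Fintype (O v)] (E : V → V → Prop) (P : ((v : V) → O v) → ℝ) : Prop :=
  ∀ (m : ℕ) (W : Fin m → Set V),
    (∀ i j, i ≠ j → past E (W i) ∩ past E (W j) = ∅) →
    ∀ f, marginal P (⋃ i, W i) f = ∏ i, marginal P (W i) f

theorem aux_past_iUnion {V ι : Type} (E : V → V → Prop) (A : ι → Set V) (x : V)
    (hx : x ∈ past E (⋃ i, A i)) : ∃ i, x ∈ past E (A i) := by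
  simp only [past, Set.mem_union, Set.mem_ofPred_eq, Set.mem_iUnion] at hx ⊢
  rcases hx with ⟨i, h⟩ | ⟨v, ⟨i, h⟩, hv⟩
  · exact ⟨i, Or.inl h⟩
  · exact ⟨i, Or.inr ⟨v, h, hv⟩⟩

theorem aux_marginal_congr {V : Type} [Fintype V] [DecidableEq V] {O : V → Type}
    [∀ v, Fintype (O v)] (P : ((v : V) → O v) → ℝ) (U : Set V) (f : (v : V) → O v)
    (z : V) (hz : z ∉ U) (x : O z) :
    marginal P U (Function.update f z x) = marginal P U f := by
  classical
  unfold marginal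
  refine Finset.sum_congr rfl fun o _ => ?_
  have : (∀ v ∈ U, o v = Function.update f z x v) ↔ (∀ v ∈ U, o v = f v) := by
    refine forall₂_congr fun v hv => ?_
    have : v ≠ z := fun h => hz (h ▸ hv)
    rw [Function.update_of_ne this]
  simp only [this]

theorem aux_marginal_sum {V : Type} [Fintype V] [DecidableEq V] {O : V → Type}
    [∀ v, Fintype (O v)] (P : ((v : V) → O v) → ℝ) (U : Set V) (f : (v : V) → O v)
    (z : V) (hz : z ∉ U) :
    marginal P U f = ∑ x : O z, marginal P (U ∪ {z}) (Function.update f z x) := by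
  classical
  unfold marginal
  rw [Finset.sum_comm]
  refine Finset.sum_congr rfl fun o _ => ?_
  have : ∀ x : O z, (∀ v ∈ U ∪ {z}, o v = Function.update f z x v) ↔
      (o z = x ∧ ∀ v ∈ U, o v = f v) := by
    intro x
    constructor
    · intro h
      refine ⟨by simpa using h z (by simp), fun v hv => ?_⟩
      have hne : v ≠ z := fun h => hz (h ▸ hv)
      have := h v (Or.inl hv)
      rwa [Function.update_of_ne hne] at this
    · rintro ⟨h1, h2⟩ v (hv | hv)
      · have hne : v ≠ z := fun h => hz (h ▸ hv)
        rw [Function.update_of_ne hne]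
        exact h2 v hv
      · obtain rfl : v = z := hv
        simpa using h1
  simp only [this, ite_and]
  simp

theorem aux_drop {V : Type} [Fintype V] [DecidableEq V] {O : V → Type}
    [∀ v, Fintype (O v)] (P : ((v : V) → O v) → ℝ) (U W : Set V)
    (z : V) (hU : z ∉ U) (hW : z ∉ W)
    (h : ∀ f, marginal P ((U ∪ {z}) ∪ W) f = marginal P (U ∪ {z}) f * marginal P W f)
    (f : (v : V) → O v) :
    marginal P (U ∪ W) f = marginal P U f * marginal P W f := by
  rw [aux_marginal_sum P (U ∪ W) f z (by simp [hU, hW]), aux_marginal_sum P U f z hU,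
    Finset.sum_mul]
  refine Finset.sum_congr rfl fun x _ => ?_
  rw [Set.union_right_comm, h, aux_marginal_congr P W f z hW]

theorem aux_pair {V : Type} [Fintype V] [DecidableEq V] {O : V → Type}
    [∀ v, Fintype (O v)] (E : V → V → Prop) (P : ((v : V) → O v) → ℝ)
    (H : ∀ U W : Set V, past E U ∩ past E W = ∅ →
        (∀ z ∉ U ∪ W,
          past E (U ∪ {z}) ∩ past E W ≠ ∅ ∧ past E U ∩ past E (W ∪ {z}) ≠ ∅) →
        ∀ f, marginal P (U ∪ W) f = marginal P U f * marginal P W f)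
    (n : ℕ) : ∀ U W : Set V, (U ∪ W)ᶜ.ncard = n → past E U ∩ past E W = ∅ →
      ∀ f, marginal P (U ∪ W) f = marginal P U f * marginal P W f := by
  induction n using Nat.strong_induction_on with
  | _ n ih =>
    intro U W hn hd
    by_cases hm : ∀ z ∉ U ∪ W,
          past E (U ∪ {z}) ∩ past E W ≠ ∅ ∧ past E U ∩ past E (W ∪ {z}) ≠ ∅
    · exact H U W hd hm
    · push Not at hm
      obtain ⟨z, hz, hm⟩ := hm
      have hzU : z ∉ U := fun h => hz (Or.inl h)
      have hzW : z ∉ W := fun h => hz (Or.inr h)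
      have hlt : ((U ∪ W) ∪ {z})ᶜ.ncard < n := by
        rw [← hn]
        refine Set.ncard_lt_ncard ?_ (Set.toFinite _)
        refine ⟨fun v hv hv' => hv (Or.inl hv'), fun h => ?_⟩
        exact h hz (Or.inr rfl)
      by_cases h1 : past E (U ∪ {z}) ∩ past E W = ∅
      · refine aux_drop P U W z hzU hzW (ih _ hlt _ _ ?_ h1)
        rw [Set.union_right_comm]
      · have h2 : past E U ∩ past E (W ∪ {z}) = ∅ := by
          exact hm (Set.nonempty_iff_ne_empty.mpr h1)
        intro f
        rw [Set.union_comm, mul_comm]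
        refine aux_drop P W U z hzW hzU (fun f => ?_) f
        rw [Set.union_comm, mul_comm]
        refine ih _ hlt _ _ ?_ h2 f
        rw [Set.union_assoc]

theorem aux_family {V : Type} [Fintype V] [DecidableEq V] {O : V → Type}
    [∀ v, Fintype (O v)] (E : V → V → Prop) (P : ((v : V) → O v) → ℝ)
    (hP1 : ∑ o, P o = 1)
    (H : ∀ U W : Set V, past E U ∩ past E W = ∅ →
        ∀ f, marginal P (U ∪ W) f = marginal P U f * marginal P W f) :
    IsCorrelation E P := by
  intro m
  induction m with
  | zero =>
    intro W _ f
    simp [marginal, hP1]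
  | succ m ih =>
    intro W hd f
    have hU : (⋃ i, W i) = W 0 ∪ ⋃ i : Fin m, W i.succ := by
      ext x
      simp [Fin.exists_fin_succ]
    rw [hU, Fin.prod_univ_succ, H, ih (fun i => W i.succ)]
    · intro i j hij
      exact hd _ _ (fun h => hij (Fin.succ_injective _ h))
    · rw [Set.eq_empty_iff_forall_notMem]
      rintro x ⟨h0, hx⟩
      obtain ⟨i, hi⟩ := aux_past_iUnion E _ x hx
      have := hd 0 i.succ (Fin.succ_ne_zero i).symm
      exact (Set.eq_empty_iff_forall_notMem.mp this) x ⟨h0, hi⟩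

theorem statement_0 {V : Type} [Fintype V] [DecidableEq V] {O : V → Type}
    [∀ v, Fintype (O v)] [∀ v, Nonempty (O v)]
    (E : V → V → Prop) (hacyc : ∀ v, ¬ Relation.TransGen E v v)
    (P : ((v : V) → O v) → ℝ) (hP0 : ∀ o, 0 ≤ P o) (hP1 : ∑ o, P o = 1) :
    IsCorrelation E P ↔
      ∀ U W : Set V, past E U ∩ past E W = ∅ →
        (∀ z ∉ U ∪ W,
          past E (U ∪ {z}) ∩ past E W ≠ ∅ ∧ past E U ∩ past E (W ∪ {z}) ≠ ∅) →
        ∀ f, marginal P (U ∪ W) f = marginal P U f * marginal P W f := by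
  constructor
  · intro h U W hd _ f
    have h2 := h 2 ![U, W] (by
      intro i j hij
      fin_cases i <;> fin_cases j
      · exact absurd rfl hij
      · simpa using hd
      · simpa [Set.inter_comm] using hd
      · exact absurd rfl hij) f
    have hU : (⋃ i, (![U, W] : Fin 2 → Set V) i) = U ∪ W := by
      ext x
      simp [Fin.exists_fin_two]
    rw [hU, Fin.prod_univ_two] at h2
    simpa using h2
  · intro H
    exact aux_family E P hP1 fun U W hd => aux_pair E P H _ U W rfl hd
end

section
/- In the n-party Bell scenario, a joint distribution P is a correlation (i.e. for every family of subsets of nodes with pairwise disjoint causal pasts, the marginal on the union factorizes into the product of marginals) if and only if P satisfies the free-will equation and the no-signalling equation for every party i = 1, …, n. -/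
/-- Nodes of the `n`-party Bell scenario: a source `s`, settings `x i` and outcomes `a i`. -/
inductive BellNode (n : ℕ) where
  | s : BellNode n
  | x : Fin n → BellNode n
  | a : Fin n → BellNode n
  deriving DecidableEq, Fintype

/-- Edge set of the `n`-party Bell scenario: `s → a i` and `x i → a i` for each party `i`. -/
def BellEdges (n : ℕ) : Finset (BellNode n × BellNode n) :=
  (Finset.univ : Finset (Fin n)).biUnion fun i =>
    {(BellNode.s, BellNode.a i), (BellNode.x i, BellNode.a i)}

/-- The free-will equation: the marginal on `{x_1, …, x_n, s}` is the product of the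
single-node marginals. -/
def FreeWill {n : ℕ} {O : BellNode n → Type} [∀ v, Fintype (O v)]
    (P : ((v : BellNode n) → O v) → ℝ) : Prop :=
  ∀ f, marginal P (Set.range BellNode.x ∪ {BellNode.s}) f
      = (∏ i, marginal P {BellNode.x i} f) * marginal P {BellNode.s} f

/-- The no-signalling equation for party `i`: the marginal on all nodes except `a i`
equals the single-node marginal of `x i` times the marginal on all nodes except `a i`
and `x i`. -/
def NoSignalling {n : ℕ} {O : BellNode n → Type} [∀ v, Fintype (O v)]
    (P : ((v : BellNode n) → O v) → ℝ) (i : Fin n) : Prop :=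
  ∀ f, marginal P {v | v ≠ BellNode.a i} f
      = marginal P {BellNode.x i} f * marginal P {v | v ≠ BellNode.a i ∧ v ≠ BellNode.x i} f

lemma bn_edge {n : ℕ} (u v : BellNode n) : (u, v) ∈ BellEdges n ↔
    ∃ i, v = BellNode.a i ∧ (u = BellNode.s ∨ u = BellNode.x i) := by
  simp only [BellEdges, Finset.mem_biUnion, Finset.mem_univ, true_and, Finset.mem_insert,
    Finset.mem_singleton, Prod.mk.injEq]
  constructor
  · rintro ⟨i, h | h⟩
    · exact ⟨i, h.2, Or.inl h.1⟩
    · exact ⟨i, h.2, Or.inr h.1⟩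
  · rintro ⟨i, h, h' | h'⟩
    · exact ⟨i, Or.inl ⟨h', h⟩⟩
    · exact ⟨i, Or.inr ⟨h', h⟩⟩

lemma bn_trans {n : ℕ} (u v : BellNode n) :
    Relation.TransGen (fun u v => (u, v) ∈ BellEdges n) u v ↔
    ∃ i, v = BellNode.a i ∧ (u = BellNode.s ∨ u = BellNode.x i) := by
  constructor
  · intro h
    induction h with
    | single h => exact (bn_edge _ _).1 h
    | tail h1 h2 ih =>
      obtain ⟨i, hi, -⟩ := ih
      obtain ⟨j, -, hj | hj⟩ := (bn_edge _ _).1 h2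
      · rw [hi] at hj; cases hj
      · rw [hi] at hj; cases hj
  · intro h
    exact Relation.TransGen.single ((bn_edge _ _).2 h)

lemma bn_past {n : ℕ} (u : BellNode n) (U : Set (BellNode n)) :
    u ∈ past (fun u v => (u, v) ∈ BellEdges n) U ↔
      u ∈ U ∨ ∃ i, BellNode.a i ∈ U ∧ (u = BellNode.s ∨ u = BellNode.x i) := by
  simp only [past, Set.mem_union, Set.mem_ofPred_eq, bn_trans]
  constructor
  · rintro (h | ⟨v, hv, i, rfl, h⟩)
    · exact Or.inl h
    · exact Or.inr ⟨i, hv, h⟩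
  · rintro (h | ⟨i, hv, h⟩)
    · exact Or.inl h
    · exact Or.inr ⟨_, hv, i, rfl, h⟩

lemma marg_congr {V : Type} [Fintype V] [DecidableEq V] {O : V → Type}
    [∀ v, Fintype (O v)] (P : ((v : V) → O v) → ℝ) (U : Set V)
    (f g : (v : V) → O v) (h : ∀ v ∈ U, f v = g v) : marginal P U f = marginal P U g := by
  unfold marginal
  refine Finset.sum_congr rfl fun o _ => ?_
  have : (∀ v ∈ U, o v = f v) ↔ (∀ v ∈ U, o v = g v) :=
    forall₂_congr fun v hv => by rw [h v hv]
  by_cases hh : ∀ v ∈ U, o v = f v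
  · rw [if_pos hh, if_pos (this.1 hh)]
  · rw [if_neg hh, if_neg (fun h2 => hh (this.2 h2))]

lemma marg_insert {V : Type} [Fintype V] [DecidableEq V] {O : V → Type}
    [∀ v, Fintype (O v)] (P : ((v : V) → O v) → ℝ) (U : Set V) (v : V) (hv : v ∉ U)
    (f : (v : V) → O v) :
    marginal P U f = ∑ y : O v, marginal P (insert v U) (Function.update f v y) := by
  classical
  unfold marginal
  rw [Finset.sum_comm]
  refine Finset.sum_congr rfl fun o _ => ?_
  have : ∀ y, (∀ w ∈ insert v U, o w = Function.update f v y w) ↔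
      (o v = y ∧ ∀ w ∈ U, o w = f w) := by
    intro y
    rw [Set.forall_mem_insert]
    refine and_congr (by simp) (forall₂_congr fun w hw => ?_)
    rw [Function.update_of_ne (by rintro rfl; exact hv hw)]
  simp only [this, ite_and]
  simp

lemma marg_empty {V : Type} [Fintype V] [DecidableEq V] {O : V → Type}
    [∀ v, Fintype (O v)] (P : ((v : V) → O v) → ℝ) (hP1 : ∑ o, P o = 1)
    (f : (v : V) → O v) : marginal P ∅ f = 1 := by
  simp [marginal, hP1]

lemma fact_down {V : Type} [Fintype V] [DecidableEq V] {O : V → Type}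
    [∀ v, Fintype (O v)] (P : ((v : V) → O v) → ℝ) (x : V) (D : Finset V) (hx : x ∉ D) :
    ∀ U : Set V,
      (∀ f, marginal P (insert x (U ∪ D)) f = marginal P {x} f * marginal P (U ∪ D) f) →
      ∀ f, marginal P (insert x U) f = marginal P {x} f * marginal P U f := by
  induction D using Finset.induction_on with
  | empty => intro U h; simpa using h
  | insert v D hvD ih =>
    intro U h f
    rw [Finset.mem_insert, not_or] at hx
    have e : U ∪ ((insert v D : Finset V) : Set V) = insert v U ∪ (D : Set V) := by
      ext w; simp; tauto
    rw [e] at h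
    have h2 := ih hx.2 (insert v U) h
    by_cases hv : v ∈ U
    · rw [Set.insert_eq_of_mem hv] at h2
      exact h2 f
    · rw [marg_insert P (insert x U) v (by
        rw [Set.mem_insert_iff, not_or]; exact ⟨fun h => hx.1 h.symm, hv⟩), marg_insert P U v hv,
        Finset.mul_sum]
      refine Finset.sum_congr rfl fun y _ => ?_
      rw [Set.insert_comm, h2]
      congr 1
      apply marg_congr
      intro w hw
      rw [Set.mem_singleton_iff] at hw
      subst hw
      rw [Function.update_of_ne hx.1]

lemma ns_step {n : ℕ} {O : BellNode n → Type} [∀ v, Fintype (O v)]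
    (P : ((v : BellNode n) → O v) → ℝ) (i : Fin n) (h : NoSignalling P i)
    (U : Set (BellNode n)) (ha : BellNode.a i ∉ U) (hx : BellNode.x i ∉ U) (f) :
    marginal P (insert (BellNode.x i) U) f = marginal P {BellNode.x i} f * marginal P U f := by
  classical
  refine fact_down P (BellNode.x i)
    ({v | v ≠ BellNode.a i ∧ v ≠ BellNode.x i} : Set (BellNode n)).toFinset (by simp) U ?_ f
  have e1 : U ∪ (({v | v ≠ BellNode.a i ∧ v ≠ BellNode.x i} : Set (BellNode n)).toFinset :
      Set (BellNode n)) = {v | v ≠ BellNode.a i ∧ v ≠ BellNode.x i} := by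
    rw [Set.coe_toFinset, Set.union_eq_right]
    intro v hv
    exact ⟨by rintro rfl; exact ha hv, by rintro rfl; exact hx hv⟩
  have e2 : insert (BellNode.x i) {v | v ≠ BellNode.a i ∧ v ≠ BellNode.x i} =
      {v : BellNode n | v ≠ BellNode.a i} := by
    ext v
    simp only [Set.mem_insert_iff, Set.mem_ofPred_eq]
    constructor
    · rintro (rfl | h)
      · simp
      · exact h.1
    · intro h
      by_cases hv : v = BellNode.x i
      · exact Or.inl hv
      · exact Or.inr ⟨h, hv⟩
  rw [e1, e2]
  exact h

lemma ns_many {n : ℕ} {O : BellNode n → Type} [∀ v, Fintype (O v)]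
    (P : ((v : BellNode n) → O v) → ℝ) (h : ∀ i, NoSignalling P i)
    (U : Set (BellNode n)) (J : Finset (Fin n)) (f)
    (ha : ∀ i ∈ J, BellNode.a i ∉ U) (hx : ∀ i ∈ J, BellNode.x i ∉ U) :
    marginal P (BellNode.x '' (J : Set (Fin n)) ∪ U) f =
      (∏ i ∈ J, marginal P {BellNode.x i} f) * marginal P U f := by
  induction J using Finset.induction_on with
  | empty => simp
  | insert i J hi ih =>
    rw [Finset.coe_insert, Set.image_insert_eq, Set.insert_union, ns_step P i (h i),
      ih (fun j hj => ha j (Finset.mem_insert_of_mem hj))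
        (fun j hj => hx j (Finset.mem_insert_of_mem hj)), Finset.prod_insert hi, mul_assoc]
    · rintro (⟨j, -, hj⟩ | h')
      · cases hj
      · exact ha i (Finset.mem_insert_self _ _) h'
    · rintro (⟨j, hj, hj'⟩ | h')
      · cases hj'
        exact hi hj
      · exact hx i (Finset.mem_insert_self _ _) h'

lemma two_aux {n : ℕ} {O : BellNode n → Type} [∀ v, Fintype (O v)]
    (P : ((v : BellNode n) → O v) → ℝ) (hP1 : ∑ o, P o = 1) (h : ∀ i, NoSignalling P i)
    (A B : Set (BellNode n))
    (hd : past (fun u v => (u, v) ∈ BellEdges n) A ∩ past (fun u v => (u, v) ∈ BellEdges n) B = ∅)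
    (hs : BellNode.s ∉ past (fun u v => (u, v) ∈ BellEdges n) B) (f) :
    marginal P (B ∪ A) f = marginal P B f * marginal P A f := by
  classical
  rw [bn_past] at hs
  push Not at hs
  have eB : B = BellNode.x '' (((BellNode.x ⁻¹' B).toFinset : Finset (Fin n)) : Set (Fin n)) := by
    rw [Set.coe_toFinset]
    ext v
    constructor
    · intro hv
      cases v with
      | s => exact absurd hv hs.1
      | x i => exact ⟨i, hv, rfl⟩
      | a i => exact absurd rfl (hs.2 i hv).1
    · rintro ⟨i, hi, rfl⟩
      exact hi
  have hdis : ∀ i, BellNode.x i ∈ B →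
      BellNode.x i ∉ past (fun u v => (u, v) ∈ BellEdges n) A := by
    intro i hi hA
    have : BellNode.x i ∈ (∅ : Set (BellNode n)) := hd ▸ ⟨hA, (bn_past _ _).2 (Or.inl hi)⟩
    exact this
  have h1 := ns_many P h A (BellNode.x ⁻¹' B).toFinset f
    (fun i hi ha => hdis i (by simpa using hi) ((bn_past _ _).2 (Or.inr ⟨i, ha, Or.inr rfl⟩)))
    (fun i hi ha => hdis i (by simpa using hi) ((bn_past _ _).2 (Or.inl ha)))
  have h2 := ns_many P h ∅ (BellNode.x ⁻¹' B).toFinset f (by simp) (by simp)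
  rw [← eB] at h1 h2
  rw [Set.union_empty, marg_empty P hP1, mul_one] at h2
  rw [h1, h2]

lemma two_fact {n : ℕ} {O : BellNode n → Type} [∀ v, Fintype (O v)]
    (P : ((v : BellNode n) → O v) → ℝ) (hP1 : ∑ o, P o = 1) (h : ∀ i, NoSignalling P i)
    (A B : Set (BellNode n))
    (hd : past (fun u v => (u, v) ∈ BellEdges n) A ∩ past (fun u v => (u, v) ∈ BellEdges n) B = ∅)
    (f) : marginal P (A ∪ B) f = marginal P A f * marginal P B f := by
  by_cases hs : BellNode.s ∈ past (fun u v => (u, v) ∈ BellEdges n) B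
  · refine two_aux P hP1 h B A (by rw [Set.inter_comm]; exact hd) (fun hA => ?_) f
    have : BellNode.s ∈ (∅ : Set (BellNode n)) := hd ▸ ⟨hA, hs⟩
    exact this
  · rw [Set.union_comm, two_aux P hP1 h A B hd hs, mul_comm]

lemma corr_two {n : ℕ} {O : BellNode n → Type} [∀ v, Fintype (O v)]
    (P : ((v : BellNode n) → O v) → ℝ)
    (h : IsCorrelation (fun u v => (u, v) ∈ BellEdges n) P) (A B : Set (BellNode n))
    (hd : past (fun u v => (u, v) ∈ BellEdges n) A ∩ past (fun u v => (u, v) ∈ BellEdges n) B = ∅)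
    (f) : marginal P (A ∪ B) f = marginal P A f * marginal P B f := by
  have := h 2 ![A, B] (by
    intro i j hij
    fin_cases i <;> fin_cases j <;> simp at hij ⊢
    · exact hd
    · rw [Set.inter_comm]; exact hd) f
  have e : (⋃ i, (![A, B] : Fin 2 → Set (BellNode n)) i) = A ∪ B := by
    ext v; simp [Fin.exists_fin_two]
  rw [e, Fin.prod_univ_two] at this
  exact this

theorem statement_2 {n : ℕ} {O : BellNode n → Type}
    [∀ v, Fintype (O v)] [∀ v, Nonempty (O v)]
    (P : ((v : BellNode n) → O v) → ℝ) (hP0 : ∀ o, 0 ≤ P o) (hP1 : ∑ o, P o = 1) :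
    IsCorrelation (fun u v => (u, v) ∈ BellEdges n) P ↔
      FreeWill P ∧ ∀ i, NoSignalling P i := by
  constructor
  · intro h
    have hns : ∀ i, NoSignalling P i := by
      intro i f
      rw [← corr_two P h]
      · congr 1
        ext v
        simp only [Set.mem_union, Set.mem_singleton_iff, Set.mem_ofPred_eq]
        constructor
        · intro h
          by_cases hv : v = BellNode.x i
          · exact Or.inl hv
          · exact Or.inr ⟨h, hv⟩
        · rintro (rfl | h)
          · simp
          · exact h.1
      · ext v
        simp only [Set.mem_inter_iff, bn_past, Set.mem_singleton_iff, Set.mem_ofPred_eq,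
          Set.mem_empty_iff_false, iff_false]
        rintro ⟨rfl | ⟨j, hj, -⟩, h2⟩
        · rcases h2 with h2 | ⟨j, hj, h2 | h2⟩
          · exact h2.2 rfl
          · cases h2
          · cases h2
            exact hj.1 rfl
        · cases hj
    refine ⟨fun f => ?_, hns⟩
    have := ns_many P hns {BellNode.s} Finset.univ f (by simp) (by simp)
    simpa using this
  · rintro ⟨-, h⟩ m W hW f
    have key : ∀ S : Finset (Fin m), marginal P (⋃ i ∈ S, W i) f = ∏ i ∈ S, marginal P (W i) f := by
      intro S
      induction S using Finset.induction_on with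
      | empty => simp [marg_empty P hP1]
      | insert k S hk ih =>
        rw [Finset.set_biUnion_insert, two_fact P hP1 h, ih, Finset.prod_insert hk]
        ext v
        simp only [Set.mem_inter_iff, Set.mem_empty_iff_false, iff_false]
        rintro ⟨h1, h2⟩
        have : ∃ j ∈ S, v ∈ past (fun u v => (u, v) ∈ BellEdges n) (W j) := by
          rw [bn_past] at h2
          rcases h2 with h2 | ⟨i, hi, h2⟩
          · simp only [Set.mem_iUnion, exists_prop] at h2
            obtain ⟨j, hj, hv⟩ := h2
            exact ⟨j, hj, (bn_past _ _).2 (Or.inl hv)⟩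
          · simp only [Set.mem_iUnion, exists_prop] at hi
            obtain ⟨j, hj, hv⟩ := hi
            exact ⟨j, hj, (bn_past _ _).2 (Or.inr ⟨i, hv, h2⟩)⟩
        obtain ⟨j, hj, hv⟩ := this
        have h3 : v ∈ (∅ : Set (BellNode n)) :=
          hW k j (by rintro rfl; exact hk hj) ▸ ⟨h1, hv⟩
        exact h3
    simpa using key Finset.univ
end

section
/- Let P be a joint distribution on the n-party Bell scenario satisfying the free-will equation and the no-signalling equation for every party i = 1, …, n. Then for every subset I ⊆ {1, …, n}, the marginal of P on the node set {a_j : j ∉ I} ∪ {x_1, …, x_n} ∪ {s} equals the marginal of P on {x_i : i ∈ I} times the marginal of P on {a_j : j ∉ I} ∪ {x_j : j ∉ I} ∪ {s}. -/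
open Classical in
lemma marg_sdiff {V : Type} [Fintype V] [DecidableEq V] {O : V → Type}
    [∀ v, Fintype (O v)] (P : ((v : V) → O v) → ℝ) (U : Set V) (v : V) (hv : v ∈ U)
    (f : (v : V) → O v) :
    marginal P (U \ {v}) f = ∑ b : O v, marginal P U (Function.update f v b) := by
  unfold marginal
  rw [Finset.sum_comm]
  refine Finset.sum_congr rfl fun o _ => ?_
  have key : ∀ b : O v, (∀ w ∈ U, o w = Function.update f v b w) ↔
      (o v = b ∧ ∀ w ∈ U \ {v}, o w = f w) := by
    intro b
    constructor
    · intro h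
      refine ⟨by simpa using h v hv, fun w hw => ?_⟩
      have hne : w ≠ v := fun e => hw.2 e
      simpa [Function.update_of_ne hne] using h w hw.1
    · rintro ⟨h1, h2⟩ w hw
      by_cases e : w = v
      · subst e; simpa using h1
      · rw [Function.update_of_ne e]; exact h2 w ⟨hw, e⟩
  simp only [key, ite_and]
  simp

lemma marg_rem1 {V : Type} [Fintype V] [DecidableEq V] {O : V → Type}
    [∀ v, Fintype (O v)] (P : ((v : V) → O v) → ℝ) (U T : Set V)
    (c : ((v : V) → O v) → ℝ) (v : V) (hU : v ∈ U) (hT : v ∈ T)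
    (hc : ∀ f b, c (Function.update f v b) = c f)
    (h : ∀ f, marginal P U f = c f * marginal P T f) :
    ∀ f, marginal P (U \ {v}) f = c f * marginal P (T \ {v}) f := by
  intro f
  rw [marg_sdiff P U v hU, marg_sdiff P T v hT, Finset.mul_sum]
  exact Finset.sum_congr rfl fun b _ => by rw [h, hc]

lemma q_update {n : ℕ} {O : BellNode n → Type} [∀ v, Fintype (O v)]
    (P : ((v : BellNode n) → O v) → ℝ) (I : Finset (Fin n)) (v : BellNode n)
    (hv : ∀ i ∈ I, v ≠ BellNode.x i) (f : (v : BellNode n) → O v) (b : O v) :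
    ∏ i ∈ I, marginal P {BellNode.x i} (Function.update f v b)
      = ∏ i ∈ I, marginal P {BellNode.x i} f := by
  refine Finset.prod_congr rfl fun i hi => marg_congr _ _ _ _ ?_
  rintro w rfl
  exact Function.update_of_ne (hv i hi).symm _ _

lemma marg_x {n : ℕ} {O : BellNode n → Type} [∀ v, Fintype (O v)]
    (P : ((v : BellNode n) → O v) → ℝ) (hP1 : ∑ o, P o = 1) (hfw : FreeWill P)
    (J : Finset (Fin n)) : ∀ f, marginal P {v | ∃ i ∈ Jᶜ, v = BellNode.x i} f
      = ∏ i ∈ Jᶜ, marginal P {BellNode.x i} f := by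
  induction J using Finset.induction_on with
  | empty =>
    intro f
    have := marg_rem1 P _ _ (fun f => ∏ i, marginal P {BellNode.x i} f) BellNode.s
      (by simp) (by simp) (fun f b => q_update P _ _ (by simp) f b) hfw f
    rw [Set.sdiff_self, marg_empty P hP1, mul_one] at this
    simp only [Finset.compl_empty]
    rw [← this]
    congr 1
    ext v; cases v <;> simp
  | insert k J hk ih =>
    intro f
    have hins : Jᶜ = insert k (insert k J)ᶜ := by
      ext i; by_cases e : i = k <;> simp [e, hk]
    have hk' : k ∉ (insert k J)ᶜ := by simp
    have := marg_rem1 P {v | ∃ i ∈ Jᶜ, v = BellNode.x i} {BellNode.x k}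
      (fun f => ∏ i ∈ (insert k J)ᶜ, marginal P {BellNode.x i} f) (BellNode.x k)
      (by simp [hk]) (by simp) (fun f b => q_update P _ _ (by
        intro i hi e
        cases e
        exact hk' hi) f b)
      (fun f => by rw [ih f, hins, Finset.prod_insert hk', mul_comm]) f
    rw [Set.sdiff_self, marg_empty P hP1, mul_one] at this
    rw [← this]
    congr 1
    ext v; cases v <;> simp [and_comm]

lemma marg_rem {V : Type} [Fintype V] [DecidableEq V] {O : V → Type}
    [∀ v, Fintype (O v)] (P : ((v : V) → O v) → ℝ) (U T : Set V)
    (c : ((v : V) → O v) → ℝ) (R : Finset V) (hU : ∀ v ∈ R, v ∈ U) (hT : ∀ v ∈ R, v ∈ T)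
    (hc : ∀ v ∈ R, ∀ f b, c (Function.update f v b) = c f)
    (h : ∀ f, marginal P U f = c f * marginal P T f) :
    ∀ f, marginal P (U \ R) f = c f * marginal P (T \ R) f := by
  induction R using Finset.induction_on with
  | empty => simpa using h
  | insert k R hk ih =>
    have e : ∀ W : Set V, W \ ((insert k R : Finset V) : Set V) = (W \ R) \ {k} := by
      intro W; ext v; simp; tauto
    rw [e, e]
    simp only [Finset.mem_insert, forall_eq_or_imp] at hU hT hc
    exact marg_rem1 P _ _ c k ⟨hU.1, by simpa using hk⟩ ⟨hT.1, by simpa using hk⟩ hc.1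
      (ih hU.2 hT.2 hc.2)

lemma main_ind {n : ℕ} {O : BellNode n → Type} [∀ v, Fintype (O v)]
    (P : ((v : BellNode n) → O v) → ℝ) (hP1 : ∑ o, P o = 1)
    (hns : ∀ i, NoSignalling P i) (I : Finset (Fin n)) :
    ∀ f, marginal P {v | ∀ i ∈ I, v ≠ BellNode.a i} f
      = (∏ i ∈ I, marginal P {BellNode.x i} f) *
        marginal P {v | ∀ i ∈ I, v ≠ BellNode.a i ∧ v ≠ BellNode.x i} f := by
  induction I using Finset.induction_on with
  | empty => intro f; simp
  | insert k I hk ih =>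
    intro f
    have hne : ∀ i ∈ I, k ≠ i := by
      rintro i hi rfl
      exact hk hi
    have h1 := marg_rem P _ _ (fun f => marginal P {BellNode.x k} f) (I.image BellNode.a)
      (by
        simp only [Finset.mem_image]
        rintro _ ⟨i, hi, rfl⟩
        simpa using (hne i hi).symm)
      (by
        simp only [Finset.mem_image]
        rintro _ ⟨i, hi, rfl⟩
        simpa using (hne i hi).symm)
      (by
        simp only [Finset.mem_image]
        rintro _ ⟨i, hi, rfl⟩ f b
        simpa using q_update P {k} (BellNode.a i) (by simp) f b) (hns k) f
    have h2 := marg_rem1 P _ _ (fun f => ∏ i ∈ I, marginal P {BellNode.x i} f) (BellNode.a k)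
      (by simpa using hne) (by simpa using hne)
      (fun f b => q_update P _ _ (by simp) f b) ih
    have h3 := marg_rem1 P _ _ (fun f => ∏ i ∈ I, marginal P {BellNode.x i} f) (BellNode.x k)
      (by simp) (by simpa using hne)
      (fun f b => q_update P _ _ (by simpa using hne) f b) h2 f
    have e1 : {v : BellNode n | ∀ i ∈ insert k I, v ≠ BellNode.a i}
        = {v | v ≠ BellNode.a k} \ ((I.image BellNode.a : Finset (BellNode n)) : Set _) := by
      ext v; simp; grind
    have e2 : ({v | v ≠ BellNode.a k ∧ v ≠ BellNode.x k} : Set (BellNode n)) \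
          ((I.image BellNode.a : Finset (BellNode n)) : Set _)
        = ({v | ∀ i ∈ I, v ≠ BellNode.a i} \ {BellNode.a k}) \ {BellNode.x k} := by
      ext v; simp; grind
    have e3 : {v : BellNode n | ∀ i ∈ insert k I, v ≠ BellNode.a i ∧ v ≠ BellNode.x i}
        = ({v | ∀ i ∈ I, v ≠ BellNode.a i ∧ v ≠ BellNode.x i} \ {BellNode.a k})
          \ {BellNode.x k} := by
      ext v; simp; grind
    rw [e1, h1, e2, h3, e3, Finset.prod_insert hk, mul_assoc]

theorem statement_3 {n : ℕ} {O : BellNode n → Type}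
    [∀ v, Fintype (O v)] [∀ v, Nonempty (O v)]
    (P : ((v : BellNode n) → O v) → ℝ) (hP0 : ∀ o, 0 ≤ P o) (hP1 : ∑ o, P o = 1)
    (hfw : FreeWill P) (hns : ∀ i, NoSignalling P i) :
    ∀ I : Set (Fin n), ∀ f,
      marginal P ({v | ∃ j ∉ I, v = BellNode.a j} ∪ Set.range BellNode.x ∪ {BellNode.s}) f
        = marginal P {v | ∃ i ∈ I, v = BellNode.x i} f *
          marginal P ({v | ∃ j ∉ I, v = BellNode.a j} ∪ {v | ∃ j ∉ I, v = BellNode.x j}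
            ∪ {BellNode.s}) f := by
  classical
  intro I f
  have h := main_ind P hP1 hns I.toFinset f
  have hx := marg_x P hP1 hfw I.toFinsetᶜ f
  rw [compl_compl] at hx
  rw [← hx] at h
  convert h using 2
  · ext v; cases v <;> simp; grind
  · congr 1; ext v; simp
  · congr 1; ext v; cases v <;> simp <;> grind
end

section
/- Given finite nonempty sets X_e for each edge e of a finite directed acyclic graph G and, for each node v, nonnegative numbers p_v(o, μ | λ) indexed by o ∈ O_v, μ ∈ ∏_{e∈out(v)} X_e and λ ∈ ∏_{e∈in(v)} X_e with ∑_{o,μ} p_v(o, μ | λ) = 1 for every λ, the function P(o) = ∑_{λ ∈ ∏_{e∈E} X_e} ∏_{v∈V} p_v(o_v, λ|_{out(v)} | λ|_{in(v)}) is a probability distribution: P(o) ≥ 0 for every joint outcome o and ∑_o P(o) = 1. -/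
/-- The type of edges of a graph on node set `V` given by an edge set `E ⊆ V × V`. -/
abbrev EdgeT {V : Type} (E : Finset (V × V)) : Type := {p : V × V // p ∈ E}

theorem aux_maximal {V : Type} (R : V → V → Prop)
    (hacyc : ∀ v : V, ¬ Relation.TransGen R v v) (S : Finset V) (hS : S.Nonempty) :
    ∃ v ∈ S, ∀ u ∈ S, ¬ R v u := by
  classical
  let _ : Std.Irrefl (Relation.TransGen R) := ⟨hacyc⟩
  let _ : IsTrans V (Relation.TransGen R) := ⟨fun _ _ _ => Relation.TransGen.trans⟩
  have _ : IsStrictOrder V (Relation.TransGen R) := {}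
  let _ : PartialOrder V := partialOrderOfSO (Relation.TransGen R)
  obtain ⟨v, hv, hm⟩ := S.exists_maximal hS
  refine ⟨v, hv, fun u hu h => ?_⟩
  have h1 : v < u := Relation.TransGen.single h
  exact absurd (hm hu h1.le) (not_le_of_gt h1)

theorem aux_sum {V : Type} [Fintype V] [DecidableEq V] (R : V → V → Prop)
    (hacyc : ∀ v : V, ¬ Relation.TransGen R v v)
    (Y : V → Type) [∀ v, Fintype (Y v)] (y0 : ∀ v, Y v)
    (f : V → (∀ v, Y v) → ℝ)
    (hind : ∀ v u y a, u ≠ v → ¬ R u v → f v (Function.update y u a) = f v y)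
    (hone : ∀ v y, ∑ a : Y v, f v (Function.update y v a) = 1) (n : ℕ) :
    ∀ S : Finset V, S.card = n →
    ∑ y ∈ Fintype.piFinset (fun v => if v ∈ S then Finset.univ else {y0 v}),
      ∏ v ∈ S, f v y = 1 := by
  induction n with
  | zero =>
    intro S hS
    rw [Finset.card_eq_zero] at hS
    subst hS
    simp
  | succ n ih =>
    intro S hS
    obtain ⟨v, hv, hmax⟩ := aux_maximal R hacyc S (Finset.card_pos.mp (by omega))
    have hc : (S.erase v).card = n := by rw [Finset.card_erase_of_mem hv]; omega
    have key : ∑ y ∈ Fintype.piFinset (fun v => if v ∈ S then Finset.univ else {y0 v}),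
        ∏ w ∈ S, f w y =
      ∑ z ∈ Fintype.piFinset (fun w => if w ∈ S.erase v then Finset.univ else {y0 w}) ×ˢ
          (Finset.univ : Finset (Y v)),
        ∏ w ∈ S, f w (Function.update z.1 v z.2) := by
      refine Finset.sum_nbij' (fun y => (Function.update y v (y0 v), y v))
        (fun z => Function.update z.1 v z.2) ?_ ?_ ?_ ?_ ?_
      · intro y hy
        simp only [Finset.mem_product, Fintype.mem_piFinset, Finset.mem_univ, and_true] at hy ⊢
        intro w
        by_cases hw : w = v
        · subst hw; simp
        · have := hy w
          simpa [hw] using this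
      · intro z hz
        simp only [Finset.mem_product, Fintype.mem_piFinset, Finset.mem_univ, and_true] at hz ⊢
        intro w
        by_cases hw : w = v
        · subst hw; simp [hv]
        · have := hz w
          simpa [hw] using this
      · intro y hy
        simp
      · intro z hz
        simp only [Finset.mem_product, Fintype.mem_piFinset, Finset.mem_univ, and_true] at hz
        have h := hz v
        simp only [Finset.mem_erase, ne_eq, not_true_eq_false, false_and, if_false,
          Finset.mem_singleton] at h
        ext1
        · simp [← h]
        · simp
      · intro y hy
        simp
    rw [key, Finset.sum_product]
    rw [← ih (S.erase v) hc]
    refine Finset.sum_congr rfl fun y _ => ?_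
    have h2 : ∀ a : Y v, ∏ w ∈ S, f w (Function.update y v a) =
        f v (Function.update y v a) * ∏ w ∈ S.erase v, f w y := by
      intro a
      rw [← Finset.mul_prod_erase S _ hv]
      congr 1
      refine Finset.prod_congr rfl fun w hw => ?_
      rw [Finset.mem_erase] at hw
      exact hind w v y a (Ne.symm hw.1) (hmax w hw.2)
    simp only [h2]
    rw [← Finset.sum_mul, hone, one_mul]

theorem statement_4 {V : Type} [Fintype V] [DecidableEq V] (E : Finset (V × V))
    (hacyc : ∀ v : V, ¬ Relation.TransGen (fun u w => (u, w) ∈ E) v v)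
    {O : V → Type} [∀ v, Fintype (O v)] [∀ v, Nonempty (O v)]
    (X : EdgeT E → Type) [∀ e, Fintype (X e)] [∀ e, Nonempty (X e)]
    (p : (v : V) → O v → ((e : {e : EdgeT E // e.1.1 = v}) → X e.1)
        → ((e : {e : EdgeT E // e.1.2 = v}) → X e.1) → ℝ)
    (hp0 : ∀ v o μ lam, 0 ≤ p v o μ lam)
    (hp1 : ∀ (v : V) (lam : (e : {e : EdgeT E // e.1.2 = v}) → X e.1),
      ∑ o : O v, ∑ μ : (e : {e : EdgeT E // e.1.1 = v}) → X e.1, p v o μ lam = 1) :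
    (∀ o : (v : V) → O v,
      0 ≤ ∑ lam : (e : EdgeT E) → X e,
            ∏ v, p v (o v) (fun e => lam e.1) (fun e => lam e.1)) ∧
    ∑ o : (v : V) → O v,
      (∑ lam : (e : EdgeT E) → X e,
        ∏ v, p v (o v) (fun e => lam e.1) (fun e => lam e.1)) = 1 := by
  refine ⟨fun o => Finset.sum_nonneg fun lam _ => Finset.prod_nonneg fun v _ => hp0 _ _ _ _, ?_⟩
  rw [Finset.sum_comm]
  let Y : V → Type := fun v => (e : {e : EdgeT E // e.1.1 = v}) → X e.1
  let f : V → (∀ v, Y v) → ℝ := fun v y =>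
    ∑ o : O v, p v o (y v) (fun e => y e.1.1.1 ⟨e.1, rfl⟩)
  let φ : ((e : EdgeT E) → X e) ≃ (∀ v, Y v) :=
    { toFun := fun lam v e => lam e.1
      invFun := fun y e => y e.1.1 ⟨e, rfl⟩
      left_inv := fun lam => rfl
      right_inv := fun y => by
        funext v e
        obtain ⟨e, rfl⟩ := e
        rfl }
  have hloop : ∀ v, (v, v) ∉ E := fun v h => hacyc v (Relation.TransGen.single h)
  have main := aux_sum (fun u w => (u, w) ∈ E) hacyc Y
    (fun v e => Classical.arbitrary _) f
    (by
      intro v u y a huv hE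
      simp only [f]
      refine Finset.sum_congr rfl fun o _ => ?_
      rw [Function.update_of_ne (Ne.symm huv)]
      congr 1
      funext e
      have : e.1.1.1 ≠ u := by
        intro h
        apply hE
        have h1 := e.1.2
        have h2 : e.1.1 = (u, v) := Prod.ext h e.2
        rwa [h2] at h1
      rw [Function.update_of_ne this])
    (by
      intro v y
      rw [← hp1 v (fun e => y e.1.1.1 ⟨e.1, rfl⟩), Finset.sum_comm]
      refine Finset.sum_congr rfl fun a _ => ?_
      refine Finset.sum_congr rfl fun o _ => ?_
      rw [Function.update_self]
      congr 1
      funext e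
      have : e.1.1.1 ≠ v := by
        intro h
        have h1 := e.1.2
        have h2 : e.1.1 = (v, v) := Prod.ext h e.2
        rw [h2] at h1
        exact hloop v h1
      rw [Function.update_of_ne this])
    _ Finset.univ rfl
  simp only [Finset.mem_univ, if_true, Fintype.piFinset_univ] at main
  rw [← main, ← φ.sum_comp]
  refine Finset.sum_congr rfl fun lam _ => ?_
  simp only [f]
  rw [Finset.prod_univ_sum, Fintype.piFinset_univ]
  rfl
end

section
/- Let P be a joint distribution on a finite directed acyclic graph G given by a finite hidden-variable model with hidden-variable sets X_e and conditionals p_v, and let U ⊆ V satisfy past(U) = U. Then for every outcome tuple o_U ∈ ∏_{v∈U} O_v, the marginal of P on U satisfies P_U(o_U) = ∑_{λ ∈ ∏_{e∈out(U)} X_e} ∏_{v∈U} p_v(o_v, λ|_{out(v)} | λ|_{in(v)}), where out(U) = ⋃_{v∈U} out(v) (note that in(v) ⊆ out(U) for every v ∈ U since past(U) = U). -/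
/-- Extension of an assignment of hidden-variable values on the edges emanating from `U`
(i.e. on `out(U)`) to all edges, by junk values elsewhere. -/
noncomputable def extendHV {V : Type} [DecidableEq V] {E : Finset (V × V)}
    {X : EdgeT E → Type} [∀ e, Nonempty (X e)] (U : Finset V)
    (lam : (e : {e : EdgeT E // e.1.1 ∈ U}) → X e.1) (e : EdgeT E) : X e :=
  if h : e.1.1 ∈ U then lam ⟨e, h⟩ else Classical.arbitrary (X e)


theorem core_sum {A B : Type} [Fintype A] [Fintype B] [Nonempty B] (T : A → B → A) (r : A → B)
    (h1 : ∀ x y, T (T x y) (r x) = x) (h2 : ∀ x y, r (T x y) = y) (F G : A → ℝ)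
    (h : ∀ x, ∑ y, F (T x y) = ∑ y, G (T x y)) : ∑ x, F x = ∑ x, G x := by
  have key : ∀ F : A → ℝ, ∑ x, ∑ y, F (T x y) = (Fintype.card B : ℝ) * ∑ x, F x := by
    intro F
    let e : A × B ≃ A × B :=
      { toFun := fun z => (T z.1 z.2, r z.1)
        invFun := fun z => (T z.1 z.2, r z.1)
        left_inv := fun z => by simp [h1, h2]
        right_inv := fun z => by simp [h1, h2] }
    have := Equiv.sum_comp e (fun z : A × B => F z.1)
    rw [Fintype.sum_prod_type, Fintype.sum_prod_type] at this
    simp only [e, Equiv.coe_fn_mk] at this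
    rw [this, Finset.mul_sum]
    simp
  have hc : (Fintype.card B : ℝ) ≠ 0 := by
    exact_mod_cast Fintype.card_ne_zero
  have := key F
  rw [Finset.sum_congr rfl (fun x _ => h x), key G] at this
  exact (mul_left_cancel₀ hc this).symm

open Classical in
noncomputable def dl (Q : Prop) : ℝ := if Q then 1 else 0

theorem dl_true {Q : Prop} (h : Q) : dl Q = 1 := if_pos h

theorem dl_false {Q : Prop} (h : ¬ Q) : dl Q = 0 := if_neg h

theorem sum_dl {B : Type} [Fintype B] (b : B) : ∑ y, dl (y = b) = 1 := by
  rw [Fintype.sum_eq_single b (fun y hy => dl_false hy), dl_true rfl]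

open Classical in
noncomputable def KK {V : Type} {E : Finset (V × V)} {O : V → Type} (X : EdgeT E → Type)
    [∀ e, Nonempty (X e)]
    (p : (v : V) → O v → ((e : {e : EdgeT E // e.1.1 = v}) → X e.1)
        → ((e : {e : EdgeT E // e.1.2 = v}) → X e.1) → ℝ)
    (U W : Finset V) (f : (v : V) → O v) (v : V)
    (x : ((v : V) → O v) × ((e : EdgeT E) → X e)) : ℝ :=
  if v ∈ U then (if x.1 v = f v then p v (x.1 v) (fun e => x.2 e.1) (fun e => x.2 e.1) else 0)
  else if v ∈ W then p v (x.1 v) (fun e => x.2 e.1) (fun e => x.2 e.1)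
  else dl (x.1 v = f v ∧
      (fun e : {e : EdgeT E // e.1.1 = v} => x.2 e.1) =
      (fun e : {e : EdgeT E // e.1.1 = v} => Classical.arbitrary (X e.1)))

open Classical in
theorem KK_step {V : Type} [Fintype V] [DecidableEq V] {E : Finset (V × V)} {O : V → Type}
    [∀ v, Fintype (O v)] [∀ v, Nonempty (O v)] (X : EdgeT E → Type)
    [∀ e, Fintype (X e)] [∀ e, Nonempty (X e)]
    (p : (v : V) → O v → ((e : {e : EdgeT E // e.1.1 = v}) → X e.1)
        → ((e : {e : EdgeT E // e.1.2 = v}) → X e.1) → ℝ)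
    (hp1 : ∀ (v : V) (lam : (e : {e : EdgeT E // e.1.2 = v}) → X e.1),
      ∑ o : O v, ∑ μ : (e : {e : EdgeT E // e.1.1 = v}) → X e.1, p v o μ lam = 1)
    (U W : Finset V) (f : (v : V) → O v) (v : V) (hvW : v ∈ W) (hvU : v ∉ U)
    (hE : ∀ w, w ∈ W ∨ w ∈ U → (v, w) ∉ E) :
    ∑ x, ∏ w, KK X p U W f w x = ∑ x, ∏ w, KK X p U (W.erase v) f w x := by
  let T : ((v : V) → O v) × ((e : EdgeT E) → X e) →
      O v × ((e : {e : EdgeT E // e.1.1 = v}) → X e.1) →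
      ((v : V) → O v) × ((e : EdgeT E) → X e) :=
    fun x y => (Function.update x.1 v y.1,
      fun e => if h : e.1.1 = v then y.2 ⟨e, h⟩ else x.2 e)
  have T1 : ∀ x y, (T x y).1 v = y.1 := fun x y => by simp [T]
  have T2 : ∀ x y (e : {e : EdgeT E // e.1.1 = v}), (T x y).2 e.1 = y.2 e := fun x y e => by
    simp [T, e.2]
  have T3 : ∀ x y w, w ≠ v → (T x y).1 w = x.1 w := fun x y w h => by simp [T, h]
  have T4 : ∀ x y (e : EdgeT E), e.1.1 ≠ v → (T x y).2 e = x.2 e := fun x y e h => by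
    simp [T, h]
  have Tin : ∀ x y w, w ∈ W ∨ w ∈ U →
      (fun e : {e : EdgeT E // e.1.2 = w} => (T x y).2 e.1) =
        fun e : {e : EdgeT E // e.1.2 = w} => x.2 e.1 := by
    intro x y w hw
    funext e
    apply T4
    intro h
    apply hE w hw
    have := e.1.2
    have h3 : e.1.1 = (v, w) := Prod.ext h e.2
    rwa [h3] at this
  have Tout : ∀ x y w, w ≠ v →
      (fun e : {e : EdgeT E // e.1.1 = w} => (T x y).2 e.1) =
        fun e : {e : EdgeT E // e.1.1 = w} => x.2 e.1 := by
    intro x y w hw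
    funext e
    apply T4
    rw [e.2]; exact hw
  have Tov : ∀ x y,
      (fun e : {e : EdgeT E // e.1.1 = v} => (T x y).2 e.1) = y.2 := by
    intro x y
    funext e
    exact T2 x y e
  have hinv : ∀ x y w, w ≠ v → KK X p U W f w (T x y) = KK X p U W f w x := by
    intro x y w hw
    unfold KK
    by_cases h1 : w ∈ U
    · simp only [h1, if_true, T3 x y w hw, Tin x y w (Or.inr h1), Tout x y w hw]
    · by_cases h2 : w ∈ W
      · simp only [h1, h2, if_true, if_false, T3 x y w hw, Tin x y w (Or.inl h2), Tout x y w hw]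
      · simp only [h1, h2, if_false, T3 x y w hw, Tout x y w hw]
  have her : ∀ x w, w ≠ v → KK X p U (W.erase v) f w x = KK X p U W f w x := by
    intro x w hw
    by_cases h1 : w ∈ U
    · simp [KK, h1]
    · by_cases h2 : w ∈ W
      · simp [KK, h1, h2, hw]
      · simp [KK, h1, h2]
  apply core_sum T (fun x => (x.1 v, fun e => x.2 e.1))
  · intro x y
    refine Prod.ext ?_ ?_
    · simp [T]
    · funext e
      by_cases h : e.1.1 = v <;> simp [T, h]
  · intro x y
    exact Prod.ext (T1 x y) (Tov x y)
  · intro x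
    have e1 : ∀ y, ∏ w, KK X p U W f w (T x y) =
        p v y.1 y.2 (fun e => x.2 e.1) * ∏ w ∈ Finset.univ.erase v, KK X p U W f w x := by
      intro y
      rw [← Finset.mul_prod_erase Finset.univ _ (Finset.mem_univ v)]
      congr 1
      · simp only [KK, hvU, hvW, if_true, if_false, T1, Tov, Tin x y v (Or.inl hvW)]
      · exact Finset.prod_congr rfl fun w hw => hinv x y w (Finset.ne_of_mem_erase hw)
    have e2 : ∀ y, ∏ w, KK X p U (W.erase v) f w (T x y) =
        dl (y = (f v, fun e : {e : EdgeT E // e.1.1 = v} => Classical.arbitrary (X e.1))) *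
          ∏ w ∈ Finset.univ.erase v, KK X p U W f w x := by
      intro y
      rw [← Finset.mul_prod_erase Finset.univ _ (Finset.mem_univ v)]
      congr 1
      · simp only [KK, hvU, if_false, T1, Tov, Finset.notMem_erase, Prod.ext_iff]
      · exact Finset.prod_congr rfl fun w hw => by
          rw [her _ w (Finset.ne_of_mem_erase hw), hinv x y w (Finset.ne_of_mem_erase hw)]
    simp only [e1, e2]
    rw [← Finset.sum_mul, ← Finset.sum_mul, Fintype.sum_prod_type, hp1, sum_dl]

theorem statement_5 {V : Type} [Fintype V] [DecidableEq V] (E : Finset (V × V))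
    (hacyc : ∀ v : V, ¬ Relation.TransGen (fun u w => (u, w) ∈ E) v v)
    {O : V → Type} [∀ v, Fintype (O v)] [∀ v, Nonempty (O v)]
    (P : ((v : V) → O v) → ℝ) (hP0 : ∀ o, 0 ≤ P o) (hP1 : ∑ o, P o = 1)
    (X : EdgeT E → Type) [∀ e, Fintype (X e)] [∀ e, Nonempty (X e)]
    (p : (v : V) → O v → ((e : {e : EdgeT E // e.1.1 = v}) → X e.1)
        → ((e : {e : EdgeT E // e.1.2 = v}) → X e.1) → ℝ)
    (hp0 : ∀ v o μ lam, 0 ≤ p v o μ lam)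
    (hp1 : ∀ (v : V) (lam : (e : {e : EdgeT E // e.1.2 = v}) → X e.1),
      ∑ o : O v, ∑ μ : (e : {e : EdgeT E // e.1.1 = v}) → X e.1, p v o μ lam = 1)
    (hmodel : ∀ o : (v : V) → O v,
      P o = ∑ lam : (e : EdgeT E) → X e,
        ∏ v, p v (o v) (fun e => lam e.1) (fun e => lam e.1))
    (U : Finset V) (hU : past (fun u w => (u, w) ∈ E) (↑U : Set V) = ↑U) :
    ∀ o : (v : V) → O v,
      marginal P (↑U : Set V) o
        = ∑ lam : (e : {e : EdgeT E // e.1.1 ∈ U}) → X e.1,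
            ∏ v ∈ U, p v (o v) (fun e => extendHV U lam e.1) (fun e => extendHV U lam e.1) := by
  classical
  intro f
  have hUc : ∀ v w, (v, w) ∈ E → w ∈ U → v ∈ U := by
    intro v w h hw
    have : v ∈ past (fun u w => (u, w) ∈ E) (↑U : Set V) :=
      Or.inr ⟨w, hw, Relation.TransGen.single h⟩
    rw [hU] at this
    exact this
  have ind : ∀ W : Finset V, (∀ v ∈ W, v ∉ U) →
      ∑ x, ∏ w, KK X p U W f w x = ∑ x, ∏ w, KK X p U ∅ f w x := by
    intro W
    induction W using Finset.strongInduction with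
    | H W ih =>
      intro hW
      rcases W.eq_empty_or_nonempty with rfl | hne
      · rfl
      · have : IsTrans V (fun a b => Relation.TransGen (fun u w => (u, w) ∈ E) b a) :=
          ⟨fun a b c h1 h2 => h2.trans h1⟩
        have : Std.Irrefl (fun a b => Relation.TransGen (fun u w => (u, w) ∈ E) b a) :=
          ⟨fun a h => hacyc a h⟩
        have wf := Finite.wellFounded_of_trans_of_irrefl
          (fun a b => Relation.TransGen (fun u w => (u, w) ∈ E) b a)
        obtain ⟨v, hv, hmin⟩ := wf.has_min (↑W : Set V) hne
        have hv' : v ∈ W := hv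
        rw [KK_step X p hp1 U W f v hv' (hW v hv')]
        · exact ih _ (Finset.erase_ssubset hv')
            (fun w hw => hW w (Finset.mem_of_mem_erase hw))
        · rintro w (hw | hw) h
          · exact hmin w hw (Relation.TransGen.single h)
          · exact hW v hv' (hUc v w h hw)
  have hL : marginal P (↑U : Set V) f = ∑ x, ∏ w, KK X p U Uᶜ f w x := by
    unfold marginal
    rw [Fintype.sum_prod_type]
    refine Finset.sum_congr rfl fun o _ => ?_
    split_ifs with h
    · rw [hmodel]
      refine Finset.sum_congr rfl fun lam _ => Finset.prod_congr rfl fun v _ => ?_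
      by_cases hv : v ∈ U
      · simp [KK, hv, h v hv]
      · simp [KK, hv]
    · push Not at h
      obtain ⟨v, hv, hne⟩ := h
      have hv' : v ∈ U := hv
      symm
      refine Finset.sum_eq_zero fun lam _ => Finset.prod_eq_zero (Finset.mem_univ v) ?_
      simp [KK, hv', hne]
  rw [hL, ind _ (fun v hv => Finset.mem_compl.1 hv)]
  symm
  apply Fintype.sum_of_injective
    (fun lam : (e : {e : EdgeT E // e.1.1 ∈ U}) → X e.1 => (f, fun e => extendHV U lam e))
  · intro a b h
    have h2 := congrArg Prod.snd h
    funext e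
    have h3 := congrFun h2 e.1
    simpa [extendHV, e.2] using h3
  · intro x hx
    by_contra hne
    have hne' := Finset.prod_ne_zero_iff.1 hne
    apply hx
    refine ⟨fun e => x.2 e.1, Prod.ext ?_ ?_⟩
    · funext v
      have := hne' v (Finset.mem_univ v)
      by_contra hc
      have hc' : ¬ x.1 v = f v := fun h => hc h.symm
      apply this
      simp [KK, hc', dl]
    · funext e
      by_cases he : e.1.1 ∈ U
      · simp [extendHV, he]
      · have := hne' e.1.1 (Finset.mem_univ _)
        simp only [KK, he, if_false, Finset.notMem_empty] at this
        have h2 : (fun e' : {e' : EdgeT E // e'.1.1 = e.1.1} => x.2 e'.1)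
            = (fun e' : {e' : EdgeT E // e'.1.1 = e.1.1} => Classical.arbitrary (X e'.1)) := by
          by_contra hc
          exact this (dl_false fun h => hc h.2)
        have h3 := congrFun h2 ⟨e, rfl⟩
        simp only [extendHV, he, dif_neg, not_false_eq_true]
        exact h3.symm
  · intro lam
    rw [← Finset.prod_subset (Finset.subset_univ U)]
    · exact Finset.prod_congr rfl fun v hv => by simp [KK, hv]
    · intro v _ hv
      have : (fun e : {e : EdgeT E // e.1.1 = v} => extendHV U lam e.1)
          = (fun e : {e : EdgeT E // e.1.1 = v} => Classical.arbitrary (X e.1)) := by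
        funext e
        have : e.1.1.1 ∉ U := by rw [e.2]; exact hv
        simp [extendHV, this]
      simp only [KK, hv, if_false, Finset.notMem_empty, this, and_self, dl_true]
end

section
/- If a joint distribution P on a finite directed acyclic graph G is a classical correlation with finite hidden variables (i.e. admits a finite hidden-variable model), then P is a correlation: for every family of subsets V_1, …, V_m ⊆ V with pairwise disjoint causal pasts, the marginal of P on V_1 ∪ … ∪ V_m equals the product of the marginals P_{V_1}, …, P_{V_m}. -/
/-- The data `(X, p)` is a hidden-variable model realizing the joint distribution `P`:
the `p v` are nonnegative, normalized conditionals turning the incoming hidden variables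
(on edges with target `v`) into an outcome in `O v` and outgoing hidden variables (on
edges with source `v`), and summing the product of conditionals over all hidden-variable
assignments reproduces `P`. -/
def IsHVRealization {V : Type} [Fintype V] [DecidableEq V] (E : Finset (V × V))
    {O : V → Type} [∀ v, Fintype (O v)] (P : ((v : V) → O v) → ℝ)
    (X : EdgeT E → Type) [∀ e, Fintype (X e)]
    (p : (v : V) → O v → ((e : {e : EdgeT E // e.1.1 = v}) → X e.1)
        → ((e : {e : EdgeT E // e.1.2 = v}) → X e.1) → ℝ) : Prop :=
  (∀ v o μ lam, 0 ≤ p v o μ lam) ∧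
  (∀ (v : V) (lam : (e : {e : EdgeT E // e.1.2 = v}) → X e.1),
    ∑ o : O v, ∑ μ : (e : {e : EdgeT E // e.1.1 = v}) → X e.1, p v o μ lam = 1) ∧
  (∀ o : (v : V) → O v,
    P o = ∑ lam : (e : EdgeT E) → X e,
      ∏ v, p v (o v) (fun e => lam e.1) (fun e => lam e.1))

/-- `P` is a classical correlation with finite hidden variables on the graph `(V, E)`:
some assignment of finite nonempty hidden-variable sets to the edges and of conditionals
to the nodes realizes `P`. -/
def IsClassicalFinHV {V : Type} [Fintype V] [DecidableEq V] (E : Finset (V × V))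
    {O : V → Type} [∀ v, Fintype (O v)] (P : ((v : V) → O v) → ℝ) : Prop :=
  ∃ (X : EdgeT E → Type) (iX : ∀ e, Fintype (X e)) (_ : ∀ e, Nonempty (X e))
    (p : (v : V) → O v → ((e : {e : EdgeT E // e.1.1 = v}) → X e.1)
        → ((e : {e : EdgeT E // e.1.2 = v}) → X e.1) → ℝ),
    @IsHVRealization V _ _ E O _ P X iX p

section Bayes
variable {V : Type} [Fintype V] [DecidableEq V] {S : V → Type} [∀ v, Fintype (S v)]

lemma bn_avg (v : V) (H : (∀ v, S v) → ℝ) :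
    ∑ s : ∀ v, S v, ∑ t : S v, H (Function.update s v t)
      = (Fintype.card (S v) : ℝ) * ∑ s, H s := by
  have h2 : ∑ x : (∀ v, S v) × S v, H (Function.update x.1 v x.2)
      = ∑ x : (∀ v, S v) × S v, H x.1 := by
    refine Fintype.sum_bijective
      (fun x : (∀ v, S v) × S v => (Function.update x.1 v x.2, x.1 v)) ?_ _ _ (fun x => rfl)
    apply Function.Involutive.bijective
    rintro ⟨s, t⟩
    simp
  rw [Fintype.sum_prod_type, Fintype.sum_prod_type] at h2
  rw [h2, Finset.mul_sum]
  simp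

/-- dependence on a set of coordinates -/
def DepOn (A : Finset V) (g : (∀ v, S v) → ℝ) : Prop :=
  ∀ s s', (∀ v ∈ A, s v = s' v) → g s = g s'

lemma bn_indep (A B : Finset V) (hAB : Disjoint A B) (F G : (∀ v, S v) → ℝ)
    (hF : DepOn A F) (hG : DepOn B G) :
    (∑ s, F s) * (∑ s, G s) = (Fintype.card (∀ v, S v) : ℝ) * ∑ s, F s * G s := by
  rw [Finset.sum_mul_sum]
  have h2 : ∑ x : (∀ v, S v) × (∀ v, S v), F x.1 * G x.2
      = ∑ x : (∀ v, S v) × (∀ v, S v), F x.1 * G x.1 := by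
    refine Fintype.sum_bijective
      (fun x : (∀ v, S v) × (∀ v, S v) => (A.piecewise x.1 x.2, A.piecewise x.2 x.1)) ?_ _ _ ?_
    · apply Function.Involutive.bijective
      rintro ⟨s, t⟩
      ext v <;> by_cases hv : v ∈ A <;> simp [hv]
    · rintro ⟨s, t⟩
      simp only
      congr 1
      · exact hF _ _ (fun v hv => by simp [hv])
      · refine hG _ _ (fun v hv => ?_)
        have : v ∉ A := fun h => Finset.disjoint_left.mp hAB h hv
        simp [this]
  rw [Fintype.sum_prod_type, Fintype.sum_prod_type] at h2
  rw [h2, Finset.mul_sum]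
  simp

variable (R : V → V → Prop) (q : V → (∀ v, S v) → ℝ)

lemma bn_remove (hirr : ∀ v, ¬ Relation.TransGen R v v)
    (hloc : ∀ v s s', s v = s' v → (∀ u, R u v → s u = s' u) → q v s = q v s')
    (hsum : ∀ v s, ∑ t : S v, q v (Function.update s v t) = 1)
    (g : (∀ v, S v) → ℝ) (A : Finset V) (hg : DepOn A g)
    (T : Finset V) (v : V) (hvT : v ∈ T) (hvA : v ∉ A) (hch : ∀ w ∈ T, ¬ R v w) :
    ∑ s, g s * ∏ w ∈ T, ((Fintype.card (S w) : ℝ) * q w s)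
      = ∑ s, g s * ∏ w ∈ T.erase v, ((Fintype.card (S w) : ℝ) * q w s) := by
  have h1 : ∀ s, g s * ∏ w ∈ T, ((Fintype.card (S w) : ℝ) * q w s)
      = (Fintype.card (S v) : ℝ) *
        (g s * (∏ w ∈ T.erase v, ((Fintype.card (S w) : ℝ) * q w s)) * q v s) := by
    intro s
    rw [← Finset.mul_prod_erase T _ hvT]; ring
  rw [Finset.sum_congr rfl (fun s _ => h1 s), ← Finset.mul_sum, ← bn_avg v]
  refine Finset.sum_congr rfl (fun s _ => ?_)
  have h2 : ∀ t : S v, g (Function.update s v t) = g s := fun t =>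
    hg _ _ (fun w hw => Function.update_of_ne (by rintro rfl; exact hvA hw) _ _)
  have h3 : ∀ t : S v, ∏ w ∈ T.erase v, ((Fintype.card (S w) : ℝ) * q w (Function.update s v t))
      = ∏ w ∈ T.erase v, ((Fintype.card (S w) : ℝ) * q w s) := fun t => by
    refine Finset.prod_congr rfl (fun w hw => ?_)
    rw [Finset.mem_erase] at hw
    congr 1
    apply hloc
    · exact Function.update_of_ne hw.1 _ _
    · intro u hu
      refine Function.update_of_ne (fun h => ?_) _ _
      subst h
      exact hch w hw.2 hu
  simp only [h2, h3]
  rw [← Finset.mul_sum, hsum, mul_one]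

lemma bn_reduce (hirr : ∀ v, ¬ Relation.TransGen R v v)
    (hloc : ∀ v s s', s v = s' v → (∀ u, R u v → s u = s' u) → q v s = q v s')
    (hsum : ∀ v s, ∑ t : S v, q v (Function.update s v t) = 1)
    (g : (∀ v, S v) → ℝ) (A : Finset V) (hg : DepOn A g)
    (hA : ∀ u v, R u v → v ∈ A → u ∈ A) (n : ℕ) :
    ∀ (T : Finset V), A ⊆ T → (T \ A).card = n →
    ∑ s, g s * ∏ w ∈ T, ((Fintype.card (S w) : ℝ) * q w s)
      = ∑ s, g s * ∏ w ∈ A, ((Fintype.card (S w) : ℝ) * q w s) := by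
  induction n with
  | zero =>
    intro T hT hc
    rw [Finset.card_eq_zero, Finset.sdiff_eq_empty_iff_subset] at hc
    rw [Finset.Subset.antisymm hc hT]
  | succ n ih =>
    intro T hT hc
    have hne : (T \ A).Nonempty := by
      rw [← Finset.card_pos]; omega
    have wf : WellFounded (Function.swap (Relation.TransGen R)) := by
      haveI : Std.Irrefl (Function.swap (Relation.TransGen R)) := ⟨fun a h => hirr a h⟩
      haveI : IsTrans V (Function.swap (Relation.TransGen R)) :=
        ⟨fun a b c h1 h2 => Relation.TransGen.trans h2 h1⟩
      exact Finite.wellFounded_of_trans_of_irrefl _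
    obtain ⟨v, hv, hmin⟩ := wf.has_min (↑(T \ A) : Set V) hne
    rw [Finset.mem_coe, Finset.mem_sdiff] at hv
    rw [bn_remove R q hirr hloc hsum g A hg T v hv.1 hv.2 ?_]
    · apply ih
      · intro a ha
        exact Finset.mem_erase.mpr ⟨fun h => hv.2 (h ▸ ha), hT ha⟩
      · rw [Finset.erase_sdiff_comm, Finset.card_erase_of_mem (by simp [hv]), hc]; rfl
    · intro w hw hR
      by_cases hwA : w ∈ A
      · exact hv.2 (hA _ _ hR hwA)
      · exact hmin w (by simp [hw, hwA]) (Relation.TransGen.single hR)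

lemma bn_prod_dep (hloc : ∀ v s s', s v = s' v → (∀ u, R u v → s u = s' u) → q v s = q v s')
    (g : (∀ v, S v) → ℝ) (A : Finset V) (hg : DepOn A g)
    (hA : ∀ u v, R u v → v ∈ A → u ∈ A) :
    DepOn A (fun s => g s * ∏ w ∈ A, ((Fintype.card (S w) : ℝ) * q w s)) := by
  intro s s' h
  simp only
  rw [hg s s' h]
  congr 1
  refine Finset.prod_congr rfl (fun w hw => ?_)
  rw [hloc w s s' (h w hw) (fun u hu => h u (hA u w hu hw))]

lemma bn_main [∀ v, Nonempty (S v)] (hirr : ∀ v, ¬ Relation.TransGen R v v)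
    (hloc : ∀ v s s', s v = s' v → (∀ u, R u v → s u = s' u) → q v s = q v s')
    (hsum : ∀ v s, ∑ t : S v, q v (Function.update s v t) = 1)
    (g h : (∀ v, S v) → ℝ) (A B : Finset V) (hg : DepOn A g) (hh : DepOn B h)
    (hA : ∀ u v, R u v → v ∈ A → u ∈ A) (hB : ∀ u v, R u v → v ∈ B → u ∈ B)
    (hAB : Disjoint A B) :
    ∑ s, (g s * h s) * ∏ w, q w s = (∑ s, g s * ∏ w, q w s) * (∑ s, h s * ∏ w, q w s) := by
  set N : ℝ := (Fintype.card (∀ v, S v) : ℝ) with hN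
  have hN0 : N ≠ 0 := by
    rw [hN]; exact_mod_cast Fintype.card_ne_zero
  have hscale : ∀ k : (∀ v, S v) → ℝ, N * ∑ s, k s * ∏ w, q w s
      = ∑ s, k s * ∏ w ∈ Finset.univ, ((Fintype.card (S w) : ℝ) * q w s) := by
    intro k
    rw [Finset.mul_sum]
    refine Finset.sum_congr rfl (fun s _ => ?_)
    rw [Finset.prod_mul_distrib, hN, Fintype.card_pi]
    push_cast
    ring
  have e1 := (hscale g).trans
    (bn_reduce R q hirr hloc hsum g A hg hA _ Finset.univ (Finset.subset_univ _) rfl)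
  have e2 := (hscale h).trans
    (bn_reduce R q hirr hloc hsum h B hh hB _ Finset.univ (Finset.subset_univ _) rfl)
  have hgh : DepOn (A ∪ B) (fun s => g s * h s) := by
    intro s s' hs
    simp only
    rw [hg s s' (fun v hv => hs v (Finset.mem_union_left _ hv)),
      hh s s' (fun v hv => hs v (Finset.mem_union_right _ hv))]
  have hU : ∀ u v, R u v → v ∈ A ∪ B → u ∈ A ∪ B := by
    intro u v hR hv
    rw [Finset.mem_union] at hv ⊢
    exact hv.imp (hA u v hR) (hB u v hR)
  have e3 := (hscale (fun s => g s * h s)).trans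
    (bn_reduce R q hirr hloc hsum _ (A ∪ B) hgh hU _ Finset.univ (Finset.subset_univ _) rfl)
  have e4 := bn_indep A B hAB _ _ (bn_prod_dep R q hloc g A hg hA)
    (bn_prod_dep R q hloc h B hh hB)
  have e5 : ∑ s, (g s * h s) * ∏ w ∈ A ∪ B, ((Fintype.card (S w) : ℝ) * q w s)
      = ∑ s, (g s * ∏ w ∈ A, ((Fintype.card (S w) : ℝ) * q w s)) *
        (h s * ∏ w ∈ B, ((Fintype.card (S w) : ℝ) * q w s)) := by
    refine Finset.sum_congr rfl (fun s _ => ?_)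
    rw [Finset.prod_union hAB]; ring
  rw [← e1, ← e2, ← e5, ← e3] at e4
  apply mul_left_cancel₀ (mul_ne_zero hN0 hN0)
  linear_combination -e4

end Bayes

open Classical in
lemma marg_binary {V : Type} [Fintype V] [DecidableEq V] (E : Finset (V × V))
    (hacyc : ∀ v : V, ¬ Relation.TransGen (fun u w => (u, w) ∈ E) v v)
    {O : V → Type} [∀ v, Fintype (O v)] [∀ v, Nonempty (O v)]
    (P : ((v : V) → O v) → ℝ)
    (hcl : IsClassicalFinHV E P) (U W : Set V)
    (hd : past (fun u w => (u, w) ∈ E) U ∩ past (fun u w => (u, w) ∈ E) W = ∅)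
    (f : ∀ v, O v) :
    marginal P (U ∪ W) f = marginal P U f * marginal P W f := by
  obtain ⟨X, iX, nX, p, -, hnorm, hP⟩ := hcl
  let S : V → Type := fun v => O v × ((e : {e : EdgeT E // e.1.1 = v}) → X e.1)
  let R : V → V → Prop := fun u w => (u, w) ∈ E
  let q : (v : V) → (∀ v, S v) → ℝ := fun v s =>
    p v (s v).1 (s v).2 (fun e => (s e.1.1.1).2 ⟨e.1, rfl⟩)
  haveI : ∀ v, Nonempty (S v) := fun v => inferInstance
  let eqv : ((∀ v, O v) × (∀ e : EdgeT E, X e)) ≃ (∀ v, S v) :=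
    { toFun := fun x v => (x.1 v, fun e => x.2 e.1)
      invFun := fun s => (fun v => (s v).1, fun e => (s e.1.1).2 ⟨e, rfl⟩)
      left_inv := fun x => rfl
      right_inv := fun s => by
        funext v
        refine Prod.ext rfl ?_
        funext e
        obtain ⟨e, rfl⟩ := e
        rfl }
  let ind : Set V → (∀ v, S v) → ℝ := fun U s => if ∀ v ∈ U, (s v).1 = f v then 1 else 0
  have hm : ∀ U : Set V, marginal P U f = ∑ s, ind U s * ∏ w, q w s := by
    intro U
    rw [← Equiv.sum_comp eqv, Fintype.sum_prod_type]
    unfold marginal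
    refine Finset.sum_congr rfl (fun o _ => ?_)
    rw [hP o]
    by_cases hc : ∀ v ∈ U, o v = f v
    · rw [if_pos hc]
      refine Finset.sum_congr rfl (fun l _ => ?_)
      have : ind U (eqv (o, l)) = 1 := if_pos hc
      rw [this, one_mul]
      rfl
    · rw [if_neg hc]
      symm
      refine Finset.sum_eq_zero (fun l _ => ?_)
      have : ind U (eqv (o, l)) = 0 := if_neg hc
      rw [this, zero_mul]
  have hloc : ∀ v s s', s v = s' v → (∀ u, R u v → s u = s' u) → q v s = q v s' := by
    intro v s s' h1 h2
    simp only [q]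
    rw [h1]
    congr 1
    funext e
    obtain ⟨e, rfl⟩ := e
    simp only
    rw [h2 e.1.1 e.2]
  have hsum : ∀ v s, ∑ t : S v, q v (Function.update s v t) = 1 := by
    intro v s
    rw [← hnorm v (fun e => (s e.1.1.1).2 ⟨e.1, rfl⟩), ← Fintype.sum_prod_type']
    refine Finset.sum_congr rfl (fun t _ => ?_)
    simp only [q, Function.update_self]
    congr 1
    funext e
    obtain ⟨e, rfl⟩ := e
    have hne : e.1.1 ≠ e.1.2 := fun h =>
      hacyc e.1.2 (Relation.TransGen.single (by have := e.2; rw [← h]; nth_rewrite 2 [h]; exact this))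
    simp only
    rw [Function.update_of_ne hne]
  have hdep : ∀ U : Set V, DepOn (past R U).toFinset (ind U) := by
    intro U s s' h
    have : (∀ v ∈ U, (s v).1 = f v) ↔ (∀ v ∈ U, (s' v).1 = f v) := by
      refine forall₂_congr (fun v hv => ?_)
      rw [h v (by rw [Set.mem_toFinset]; exact Or.inl hv)]
    simp only [ind, this]
  have hanc : ∀ U : Set V, ∀ u v, R u v → v ∈ (past R U).toFinset → u ∈ (past R U).toFinset := by
    intro U u v hR hv
    rw [Set.mem_toFinset] at hv ⊢
    right
    rcases hv with hv | ⟨w, hw, hvw⟩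
    · exact ⟨v, hv, Relation.TransGen.single hR⟩
    · exact ⟨w, hw, Relation.TransGen.head hR hvw⟩
  have hmul : ∀ s, ind (U ∪ W) s = ind U s * ind W s := by
    intro s
    have : (∀ v ∈ U ∪ W, (s v).1 = f v) ↔
      (∀ v ∈ U, (s v).1 = f v) ∧ (∀ v ∈ W, (s v).1 = f v) := by
      simp only [Set.mem_union, or_imp, forall_and]
    simp only [ind, this, ite_and]
    split_ifs <;> simp
  rw [hm, hm, hm, Finset.sum_congr rfl (fun s _ => by rw [hmul s])]
  refine bn_main R q hacyc hloc hsum _ _ _ _ (hdep U) (hdep W) (hanc U) (hanc W) ?_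
  rw [Set.disjoint_toFinset]
  exact Set.disjoint_iff_inter_eq_empty.mpr hd

theorem statement_6 {V : Type} [Fintype V] [DecidableEq V] (E : Finset (V × V))
    (hacyc : ∀ v : V, ¬ Relation.TransGen (fun u w => (u, w) ∈ E) v v)
    {O : V → Type} [∀ v, Fintype (O v)] [∀ v, Nonempty (O v)]
    (P : ((v : V) → O v) → ℝ) (hP0 : ∀ o, 0 ≤ P o) (hP1 : ∑ o, P o = 1)
    (hcl : IsClassicalFinHV E P) :
    ∀ (m : ℕ) (W : Fin m → Set V),
      (∀ i j, i ≠ j →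
        past (fun u w => (u, w) ∈ E) (W i) ∩ past (fun u w => (u, w) ∈ E) (W j) = ∅) →
      ∀ f, marginal P (⋃ i, W i) f = ∏ i, marginal P (W i) f := by
  intro m W hW f
  have key : ∀ I : Finset (Fin m),
      marginal P (⋃ i ∈ I, W i) f = ∏ i ∈ I, marginal P (W i) f := by
    intro I
    induction I using Finset.induction_on with
    | empty => simp [marginal, hP1]
    | insert a I ha ih =>
      rw [Finset.set_biUnion_insert, Finset.prod_insert ha, ← ih]
      apply marg_binary E hacyc P hcl
      rw [Set.eq_empty_iff_forall_notMem]
      rintro x ⟨h1, h2⟩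
      have : ∃ i ∈ I, x ∈ past (fun u w => (u, w) ∈ E) (W i) := by
        rcases h2 with h2 | ⟨v, hv, h2⟩
        · simp only [Set.mem_iUnion] at h2
          obtain ⟨i, hi, h2⟩ := h2
          exact ⟨i, hi, Or.inl h2⟩
        · simp only [Set.mem_iUnion] at hv
          obtain ⟨i, hi, hv⟩ := hv
          exact ⟨i, hi, Or.inr ⟨v, hv, h2⟩⟩
      obtain ⟨i, hi, hx⟩ := this
      have hne : a ≠ i := fun h => ha (h ▸ hi)
      have := hW a i hne
      rw [Set.eq_empty_iff_forall_notMem] at this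
      exact this x ⟨h1, hx⟩
  simpa using key Finset.univ
end

section
/- In the n-party Bell scenario, a joint distribution P is a classical correlation with finite hidden variables if and only if there exist a finite nonempty set Λ, nonnegative numbers q(λ | o_s) for λ ∈ Λ and o_s ∈ O_s with ∑_{λ∈Λ} q(λ | o_s) = 1 for every o_s, and nonnegative numbers r_i(o_{a_i} | o_{x_i}, λ) for each party i with ∑_{o_{a_i}} r_i(o_{a_i} | o_{x_i}, λ) = 1 for all o_{x_i}, λ, such that for every joint outcome o: P(o) = (∑_{λ∈Λ} ∏_{i=1}^n r_i(o_{a_i} | o_{x_i}, λ) · q(λ | o_s)) · (∏_{i=1}^n P_{x_i}(o_{x_i})) · P_s(o_s), where P_{x_i} and P_s denote the single-node marginals of P. -/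
/-- `(Λ, q, r)` is a local hidden-variable model for `P` in the `n`-party Bell scenario:
`q(λ | o_s)` is a normalized distribution over `Λ` for each source outcome, each
`r_i(o_{a_i} | o_{x_i}, λ)` is a normalized response function, and
`P(o) = (∑ λ, ∏ i, r_i(o_{a_i} | o_{x_i}, λ) · q(λ | o_s)) · ∏ i P_{x_i}(o_{x_i}) · P_s(o_s)`. -/
def IsBellLocalModel {n : ℕ} {O : BellNode n → Type} [∀ v, Fintype (O v)]
    (P : ((v : BellNode n) → O v) → ℝ) (Λ : Type) [Fintype Λ]
    (q : Λ → O BellNode.s → ℝ)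
    (r : (i : Fin n) → O (BellNode.a i) → O (BellNode.x i) → Λ → ℝ) : Prop :=
  (∀ lam os, 0 ≤ q lam os) ∧
  (∀ os, ∑ lam : Λ, q lam os = 1) ∧
  (∀ i oa ox lam, 0 ≤ r i oa ox lam) ∧
  (∀ (i : Fin n) ox lam, ∑ oa : O (BellNode.a i), r i oa ox lam = 1) ∧
  (∀ o : (v : BellNode n) → O v,
    P o = (∑ lam : Λ,
        (∏ i, r i (o (BellNode.a i)) (o (BellNode.x i)) lam) * q lam (o BellNode.s))
      * (∏ i, marginal P {BellNode.x i} o) * marginal P {BellNode.s} o)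

namespace BellAux
open Classical

lemma node_prod {n : ℕ} (f : BellNode n → ℝ) :
    ∏ v, f v = f .s * (∏ i, f (.x i)) * ∏ i, f (.a i) := by
  let e : (Unit ⊕ Fin n) ⊕ Fin n ≃ BellNode n :=
    { toFun := fun t => match t with
        | .inl (.inl _) => .s
        | .inl (.inr i) => .x i
        | .inr i => .a i
      invFun := fun v => match v with
        | .s => .inl (.inl ())
        | .x i => .inl (.inr i)
        | .a i => .inr i
      left_inv := by rintro ((_ | _) | _) <;> rfl
      right_inv := by rintro (_ | _ | _) <;> rfl }
  rw [← e.prod_comp]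
  simp [e, Fintype.prod_sum_type]

def outEquiv {n : ℕ} (O : BellNode n → Type) :
    (O .s × ((i : Fin n) → O (.x i)) × ((i : Fin n) → O (.a i))) ≃ ((v : BellNode n) → O v) where
  toFun t := fun v => match v with
    | .s => t.1
    | .x i => t.2.1 i
    | .a i => t.2.2 i
  invFun o := (o .s, fun i => o (.x i), fun i => o (.a i))
  left_inv _ := rfl
  right_inv o := by funext v; cases v <;> rfl

lemma prod_sum' {n : ℕ} {A : Fin n → Type} [∀ i, Fintype (A i)] (f : (i : Fin n) → A i → ℝ) :
    ∑ x : (i : Fin n) → A i, ∏ i, f i (x i) = ∏ i, ∑ y, f i y := by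
  rw [Finset.prod_univ_sum, Fintype.piFinset_univ]

lemma sum_ind {A : Type} [Fintype A] (a : A) [D : ∀ x, Decidable (x = a)] :
    ∑ x, (if x = a then (1:ℝ) else 0) = 1 := by
  rw [Finset.sum_eq_single a] <;> simp +contextual

/-- Intermediate form. -/
lemma weighted {n : ℕ} {O : BellNode n → Type} [∀ v, Fintype (O v)]
    (P : ((v : BellNode n) → O v) → ℝ) {S : Type} [Fintype S]
    (ps : O .s → S → ℝ) (R : (i : Fin n) → O (.a i) → O (.x i) → S → ℝ)
    (w : (i : Fin n) → O (.x i) → ℝ)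
    (hw : ∀ i ox σ, ∑ oa, R i oa ox σ = w i ox)
    (hP : ∀ o, P o = ∑ σ, ps (o .s) σ * ∏ i, R i (o (.a i)) (o (.x i)) σ)
    (g : O .s → ℝ) (h : (i : Fin n) → O (.x i) → ℝ) :
    ∑ o, g (o .s) * (∏ i, h i (o (.x i))) * P o =
      (∑ os, g os * ∑ σ, ps os σ) * ∏ i, ∑ ox, h i ox * w i ox := by
  have key : ∀ σ, ∑ ox : (i : Fin n) → O (.x i), ∑ oa : (i : Fin n) → O (.a i),
      ∏ i, (h i (ox i) * R i (oa i) (ox i) σ) = ∏ i, ∑ ox, h i ox * w i ox := by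
    intro σ
    rw [← prod_sum']
    refine Finset.sum_congr rfl fun ox _ => ?_
    rw [prod_sum' (fun i y => h i (ox i) * R i y (ox i) σ)]
    refine Finset.prod_congr rfl fun i _ => ?_
    rw [← Finset.mul_sum, hw]
  rw [← (outEquiv O).sum_comp, Fintype.sum_prod_type, Finset.sum_mul]
  refine Finset.sum_congr rfl fun os _ => ?_
  rw [Finset.mul_sum, Finset.sum_mul, Fintype.sum_prod_type]
  have : ∀ σ, g os * ps os σ * ∏ i, ∑ ox, h i ox * w i ox =
      ∑ ox : (i : Fin n) → O (.x i), ∑ oa : (i : Fin n) → O (.a i),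
        g os * ps os σ * ∏ i, (h i (ox i) * R i (oa i) (ox i) σ) := by
    intro σ
    rw [← key σ, Finset.mul_sum]
    simp_rw [Finset.mul_sum]
  rw [Finset.sum_congr rfl (fun σ _ => this σ)]
  conv_rhs => rw [Finset.sum_comm]
  refine Finset.sum_congr rfl fun ox _ => ?_
  conv_rhs => rw [Finset.sum_comm]
  refine Finset.sum_congr rfl fun oa _ => ?_
  rw [hP, Finset.mul_sum]
  refine Finset.sum_congr rfl fun σ _ => ?_
  rw [Finset.prod_mul_distrib]
  simp only [outEquiv, Equiv.coe_fn_mk]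
  ring

lemma toBell {n : ℕ} {O : BellNode n → Type} [∀ v, Fintype (O v)] [∀ v, Nonempty (O v)]
    (P : ((v : BellNode n) → O v) → ℝ) {S : Type} [Fintype S] [Nonempty S]
    (ps : O .s → S → ℝ) (R : (i : Fin n) → O (.a i) → O (.x i) → S → ℝ)
    (w : (i : Fin n) → O (.x i) → ℝ)
    (ps0 : ∀ o σ, 0 ≤ ps o σ) (R0 : ∀ i oa ox σ, 0 ≤ R i oa ox σ)
    (ps1 : ∑ os, ∑ σ, ps os σ = 1) (w1 : ∀ i, ∑ ox, w i ox = 1)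
    (hw : ∀ i ox σ, ∑ oa, R i oa ox σ = w i ox)
    (hP : ∀ o, P o = ∑ σ, ps (o .s) σ * ∏ i, R i (o (.a i)) (o (.x i)) σ) :
    ∃ (q : S → O BellNode.s → ℝ)
        (r : (i : Fin n) → O (BellNode.a i) → O (BellNode.x i) → S → ℝ),
        IsBellLocalModel P S q r := by
  have ms : ∀ o, marginal P {BellNode.s} o = ∑ σ, ps (o .s) σ := by
    intro o
    have := weighted P ps R w hw hP (fun z => if z = o .s then 1 else 0) (fun _ _ => 1)
    simp [w1] at this
    simpa [marginal] using this
  have mx : ∀ o i, marginal P {BellNode.x i} o = w i (o (.x i)) := by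
    intro o i
    have := weighted P ps R w hw hP (fun _ => 1)
      (fun j z => if j = i ∧ z ≠ o (.x j) then 0 else 1)
    simp only [one_mul, ps1] at this
    rw [Finset.prod_eq_single i (fun j _ hj => by simp [hj, w1]) (by simp)] at this
    have h2 : ∀ o' : (v : BellNode n) → O v,
        (∏ j, if j = i ∧ o' (.x j) ≠ o (.x j) then (0:ℝ) else 1)
          = if o' (.x i) = o (.x i) then 1 else 0 := by
      intro o'
      rw [Finset.prod_eq_single i (fun j _ hj => by simp [hj]) (by simp)]
      by_cases h : o' (.x i) = o (.x i) <;> simp [h]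
    simp only [h2] at this
    have h3 : ∑ z, (if True ∧ z ≠ o (.x i) then (0:ℝ) else 1) * w i z = w i (o (.x i)) := by
      rw [Finset.sum_eq_single (o (.x i))] <;> simp +contextual
    rw [h3] at this
    rw [← this]
    simp [marginal]
  refine ⟨fun σ os => if ∑ τ, ps os τ = 0 then 1 / Fintype.card S else ps os σ / ∑ τ, ps os τ,
    fun i oa ox σ => if w i ox = 0 then 1 / Fintype.card (O (.a i)) else R i oa ox σ / w i ox,
    ?_, ?_, ?_, ?_, ?_⟩
  · intro σ os
    have := Finset.sum_nonneg (fun τ (_ : τ ∈ Finset.univ) => ps0 os τ)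
    have := ps0 os σ
    dsimp only
    split_ifs <;> positivity
  · intro os
    dsimp only
    split_ifs with h
    · simp
    · rw [← Finset.sum_div, div_self h]
  · intro i oa ox σ
    have h1 := hw i ox σ
    have := Finset.sum_nonneg (fun τ (_ : τ ∈ Finset.univ) => R0 i τ ox σ)
    rw [h1] at this
    have := R0 i oa ox σ
    dsimp only
    split_ifs <;> positivity
  · intro i ox σ
    dsimp only
    split_ifs with h
    · simp
    · rw [← Finset.sum_div, hw, div_self h]
  · intro o
    simp only [ms, mx]
    rw [hP, mul_assoc, Finset.sum_mul]
    refine Finset.sum_congr rfl fun σ _ => ?_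
    have e1 : ps (o .s) σ = (if ∑ τ, ps (o .s) τ = 0 then 1 / (Fintype.card S : ℝ)
        else ps (o .s) σ / ∑ τ, ps (o .s) τ) * ∑ τ, ps (o .s) τ := by
      split_ifs with h
      · rw [h, mul_zero]
        exact (Finset.sum_eq_zero_iff_of_nonneg (fun τ _ => ps0 _ τ)).1 h σ (Finset.mem_univ _)
      · field_simp
    have e2 : ∀ i, R i (o (.a i)) (o (.x i)) σ = (if w i (o (.x i)) = 0 then
        1 / (Fintype.card (O (.a i)) : ℝ) else R i (o (.a i)) (o (.x i)) σ / w i (o (.x i)))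
          * w i (o (.x i)) := by
      intro i
      split_ifs with h
      · rw [h, mul_zero]
        rw [← hw i _ σ] at h
        exact (Finset.sum_eq_zero_iff_of_nonneg (fun τ _ => R0 _ τ _ _)).1 h _ (Finset.mem_univ _)
      · field_simp
    conv_lhs => rw [e1, Finset.prod_congr rfl (fun i _ => e2 i), Finset.prod_mul_distrib]
    ring

lemma edge_cases {n : ℕ} (e : EdgeT (BellEdges n)) :
    ∃ i, e.1.2 = .a i ∧ (e.1.1 = .s ∨ e.1.1 = .x i) := by
  obtain ⟨⟨u, v⟩, h⟩ := e
  simp [BellEdges] at h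
  obtain ⟨i, ⟨h1, h2⟩ | ⟨h1, h2⟩⟩ := h <;> exact ⟨i, by simp [h1, h2]⟩

lemma src_ne_a {n : ℕ} (e : EdgeT (BellEdges n)) (i : Fin n) : e.1.1 ≠ .a i := by
  obtain ⟨j, _, h | h⟩ := edge_cases e <;> simp [h]

lemma src_of_tgt {n : ℕ} (e : EdgeT (BellEdges n)) (i : Fin n) (h : e.1.2 = .a i)
    (hs : ¬ e.1.1 = .s) : e.1.1 = .x i := by
  obtain ⟨j, h', h2 | h2⟩ := edge_cases e
  · exact absurd h2 hs
  · rw [h] at h'; cases h'; exact h2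

lemma tgt_a {n : ℕ} (e : EdgeT (BellEdges n)) : e.1.2 ≠ .s ∧ ∀ i, e.1.2 ≠ .x i := by
  obtain ⟨j, h', _⟩ := edge_cases e
  simp [h']

instance {n : ℕ} (i : Fin n) : IsEmpty {e : EdgeT (BellEdges n) // e.1.1 = .a i} :=
  ⟨fun e => src_ne_a e.1 i e.2⟩
instance {n : ℕ} (i : Fin n) : IsEmpty {e : EdgeT (BellEdges n) // e.1.2 = .x i} :=
  ⟨fun e => (tgt_a e.1).2 i e.2⟩
instance {n : ℕ} : IsEmpty {e : EdgeT (BellEdges n) // e.1.2 = BellNode.s} :=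
  ⟨fun e => (tgt_a e.1).1 e.2⟩

abbrev Out {n : ℕ} (X : EdgeT (BellEdges n) → Type) (v : BellNode n) : Type :=
  (e : {e : EdgeT (BellEdges n) // e.1.1 = v}) → X e.1

def join {n : ℕ} {X : EdgeT (BellEdges n) → Type} (t : Out X .s × ((i : Fin n) → Out X (.x i))) :
    (e : EdgeT (BellEdges n)) → X e := fun e =>
  match h : e.1.1 with
  | .s => t.1 ⟨e, h⟩
  | .x i => t.2 i ⟨e, h⟩
  | .a i => absurd h (src_ne_a e i)

lemma join_s {n : ℕ} {X : EdgeT (BellEdges n) → Type} (t : Out X .s × ((i : Fin n) → Out X (.x i)))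
    (e : EdgeT (BellEdges n)) (h : e.1.1 = .s) : join t e = t.1 ⟨e, h⟩ := by
  unfold join
  split
  · rfl
  · rename_i h'; simp [h] at h'
  · rename_i h'; simp [h] at h'

lemma join_x {n : ℕ} {X : EdgeT (BellEdges n) → Type} (t : Out X .s × ((i : Fin n) → Out X (.x i)))
    (e : EdgeT (BellEdges n)) (i : Fin n) (h : e.1.1 = .x i) : join t e = t.2 i ⟨e, h⟩ := by
  unfold join
  split
  · rename_i h'; simp [h] at h'
  · rename_i j h'
    have : j = i := by rw [h] at h'; cases h'; rfl
    subst this; rfl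
  · rename_i h'; simp [h] at h'

def joinEquiv {n : ℕ} (X : EdgeT (BellEdges n) → Type) :
    (Out X .s × ((i : Fin n) → Out X (.x i))) ≃ ((e : EdgeT (BellEdges n)) → X e) where
  toFun := join
  invFun lam := (fun e => lam e.1, fun i e => lam e.1)
  left_inv t := by
    refine Prod.ext ?_ ?_
    · funext e; exact join_s t e.1 e.2
    · funext i e; exact join_x t e.1 i e.2
  right_inv lam := by
    funext e
    obtain ⟨i, _, h | h⟩ := edge_cases e
    · rw [join_s _ _ h]
    · rw [join_x _ _ i h]

def comb {n : ℕ} {X : EdgeT (BellEdges n) → Type} (i : Fin n) (σ : Out X .s) (μ : Out X (.x i)) :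
    (e : {e : EdgeT (BellEdges n) // e.1.2 = .a i}) → X e.1 := fun e =>
  if h : e.1.1.1 = .s then σ ⟨e.1, h⟩ else μ ⟨e.1, src_of_tgt e.1 i e.2 h⟩

lemma join_comb {n : ℕ} {X : EdgeT (BellEdges n) → Type}
    (t : Out X .s × ((i : Fin n) → Out X (.x i))) (i : Fin n) :
    (fun e : {e : EdgeT (BellEdges n) // e.1.2 = .a i} => join t e.1) = comb i t.1 (t.2 i) := by
  funext e
  unfold comb
  split_ifs with h
  · exact join_s t _ h
  · exact join_x t _ i _

lemma forward {n : ℕ} {O : BellNode n → Type}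
    [∀ v, Fintype (O v)] [∀ v, Nonempty (O v)]
    (P : ((v : BellNode n) → O v) → ℝ) (H : IsClassicalFinHV (BellEdges n) P) :
      ∃ (Λ : Type) (iΛ : Fintype Λ) (_ : Nonempty Λ)
        (q : Λ → O BellNode.s → ℝ)
        (r : (i : Fin n) → O (BellNode.a i) → O (BellNode.x i) → Λ → ℝ),
        @IsBellLocalModel n O _ P Λ iΛ q r := by
  obtain ⟨X, iX, nX, p, p0, p1, hP⟩ := H
  refine ⟨Out X .s, inferInstance, inferInstance, ?_⟩
  have pa1 : ∀ i lam, ∑ o, p (.a i) o default lam = 1 := by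
    intro i lam
    rw [← p1 (.a i) lam]
    simp only [Fintype.sum_unique]
  refine toBell P (fun o σ => p .s o σ default)
    (fun i oa ox σ => ∑ μ : Out X (.x i), p (.x i) ox μ default * p (.a i) oa default (comb i σ μ))
    (fun i ox => ∑ μ : Out X (.x i), p (.x i) ox μ default) (fun _ _ => p0 _ _ _ _)
    (fun _ _ _ _ => Finset.sum_nonneg fun _ _ => mul_nonneg (p0 _ _ _ _) (p0 _ _ _ _))
    ?_ ?_ ?_ ?_
  · convert p1 .s default
  · intro i; convert p1 (.x i) default
  · intro i ox σ
    rw [Finset.sum_comm]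
    simp_rw [← Finset.mul_sum, pa1, mul_one]
  · intro o
    rw [hP]
    have e := (joinEquiv X).sum_comp
      (fun lam => ∏ v, p v (o v) (fun e => lam e.1) (fun e => lam e.1))
    refine Eq.trans (Eq.trans ?_ e.symm) ?_
    · congr
    rw [Fintype.sum_prod_type]
    refine Finset.sum_congr rfl fun σ _ => ?_
    rw [← prod_sum' (fun i μ => p (.x i) (o (.x i)) μ default *
      p (.a i) (o (.a i)) default (comb i σ μ)), Finset.mul_sum]
    refine Finset.sum_congr rfl fun ξ _ => ?_
    rw [node_prod, mul_assoc, ← Finset.prod_mul_distrib]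
    have hs : (fun e : {e : EdgeT (BellEdges n) // e.1.1 = .s} => joinEquiv X (σ, ξ) e.1) = σ := by
      funext e; exact join_s _ _ e.2
    have hx : ∀ i, (fun e : {e : EdgeT (BellEdges n) // e.1.1 = .x i} =>
        joinEquiv X (σ, ξ) e.1) = ξ i := by
      intro i; funext e; exact join_x _ _ i e.2
    have ha : ∀ i, (fun e : {e : EdgeT (BellEdges n) // e.1.2 = .a i} =>
        joinEquiv X (σ, ξ) e.1) = comb i σ (ξ i) := fun i => join_comb (σ, ξ) i
    congr 1
    · rw [hs]; congr 1; exact Subsingleton.elim _ _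
    · refine Finset.prod_congr rfl fun i _ => ?_
      rw [hx, ha]
      congr 2
      · exact Subsingleton.elim _ _
      · exact Subsingleton.elim _ _

def eS {n : ℕ} (i : Fin n) : {e : EdgeT (BellEdges n) // e.1.2 = .a i} :=
  ⟨⟨(.s, .a i), by simp [BellEdges]⟩, rfl⟩
def eX {n : ℕ} (i : Fin n) : {e : EdgeT (BellEdges n) // e.1.2 = .a i} :=
  ⟨⟨(.x i, .a i), by simp [BellEdges]⟩, rfl⟩

lemma backward {n : ℕ} {O : BellNode n → Type}
    [∀ v, Fintype (O v)] [∀ v, Nonempty (O v)]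
    (P : ((v : BellNode n) → O v) → ℝ) (hP0 : ∀ o, 0 ≤ P o) (hP1 : ∑ o, P o = 1)
    {Λ : Type} [Fintype Λ] [Nonempty Λ]
    (q : Λ → O BellNode.s → ℝ)
    (r : (i : Fin n) → O (BellNode.a i) → O (BellNode.x i) → Λ → ℝ)
    (H : IsBellLocalModel P Λ q r) : IsClassicalFinHV (BellEdges n) P := by
  obtain ⟨q0, q1, r0, r1, hP⟩ := H
  let m : (v : BellNode n) → O v → ℝ := fun v y => ∑ o, if o v = y then P o else 0
  have hm : ∀ v o, marginal P {v} o = m v (o v) := by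
    intro v o; simp [marginal, m]
  have m0 : ∀ v y, 0 ≤ m v y := by
    intro v y
    refine Finset.sum_nonneg fun o _ => ?_
    split_ifs
    · exact hP0 o
    · exact le_rfl
  have m1 : ∀ v, ∑ y, m v y = 1 := by
    intro v
    simp only [m]
    rw [Finset.sum_comm]
    simp [hP1]
  obtain ⟨l0⟩ : Nonempty Λ := inferInstance
  let o0 : (v : BellNode n) → O v := fun v => Classical.choice inferInstance
  let T : Type := Λ × ((v : BellNode n) → O v)
  let cx : (i : Fin n) → O (.x i) → T := fun i y => (l0, Function.update o0 (.x i) y)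
  let X : EdgeT (BellEdges n) → Type := fun _ => T
  let p : (v : BellNode n) → O v → ({e : EdgeT (BellEdges n) // e.1.1 = v} → T)
        → ({e : EdgeT (BellEdges n) // e.1.2 = v} → T) → ℝ := fun v => match v with
    | .s => fun o μ _ => ∑ l, q l o * m .s o * if μ = fun _ => (l, o0) then 1 else 0
    | .x i => fun o μ _ => m (.x i) o * if μ = fun _ => cx i o then 1 else 0
    | .a i => fun o _ lam => r i o ((lam (eX i)).2 (.x i)) (lam (eS i)).1
  refine ⟨X, fun _ => (inferInstance : Fintype T), fun _ => ⟨(l0, o0)⟩, p, ?_, ?_, ?_⟩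
  · intro v o μ lam
    cases v with
    | s =>
      refine Finset.sum_nonneg fun l _ => mul_nonneg (mul_nonneg (q0 _ _) (m0 _ _)) ?_
      split_ifs <;> norm_num
    | x i =>
      refine mul_nonneg (m0 _ _) ?_
      split_ifs <;> norm_num
    | a i => exact r0 _ _ _ _
  · intro v lam
    cases v with
    | s =>
      rw [← m1 .s]
      refine Finset.sum_congr rfl fun o _ => ?_
      show ∑ μ : {e : EdgeT (BellEdges n) // e.1.1 = .s} → T,
        ∑ l, q l o * m .s o * (if μ = fun _ => (l, o0) then 1 else 0) = _
      rw [Finset.sum_comm]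
      simp_rw [← Finset.mul_sum]
      rw [Finset.sum_congr rfl (fun l _ => by rw [sum_ind, mul_one]), ← Finset.sum_mul, q1, one_mul]
    | x i =>
      rw [← m1 (.x i)]
      refine Finset.sum_congr rfl fun o _ => ?_
      show ∑ μ : {e : EdgeT (BellEdges n) // e.1.1 = .x i} → T,
        m (.x i) o * (if μ = fun _ => cx i o then 1 else 0) = _
      rw [← Finset.mul_sum, sum_ind, mul_one]
    | a i =>
      simp only [Fintype.sum_unique]
      exact r1 i _ _
  · intro o
    rw [hP]
    simp only [hm]
    have e := (joinEquiv X).sum_comp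
      (fun lam => ∏ v, p v (o v) (fun e => lam e.1) (fun e => lam e.1))
    refine Eq.trans ?_ (e.trans ?_)
    swap
    · congr
    rw [Fintype.sum_prod_type]
    have ev : ∀ (σ : Out X .s) (ξ : (i : Fin n) → Out X (.x i)),
        ∏ v, p v (o v) (fun e => joinEquiv X (σ, ξ) e.1) (fun e => joinEquiv X (σ, ξ) e.1) =
        ∑ l, (q l (o .s) * m .s (o .s)) * (if σ = fun _ => (l, o0) then 1 else 0) *
          ((∏ i, m (.x i) (o (.x i))) * (if ξ = fun i _ => cx i (o (.x i)) then 1 else 0) *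
          ∏ i, r i (o (.a i)) (o (.x i)) l) := by
      intro σ ξ
      have hs : (fun e : {e : EdgeT (BellEdges n) // e.1.1 = .s} =>
          joinEquiv X (σ, ξ) e.1) = σ := by
        funext e; exact join_s _ _ e.2
      have hx : ∀ i, (fun e : {e : EdgeT (BellEdges n) // e.1.1 = .x i} =>
          joinEquiv X (σ, ξ) e.1) = ξ i := by
        intro i; funext e; exact join_x _ _ i e.2
      have hes : ∀ i : Fin n, joinEquiv X (σ, ξ) (eS i).1 = σ ⟨(eS i).1, rfl⟩ :=
        fun i => join_s (σ, ξ) (eS i).1 rfl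
      have hex : ∀ i : Fin n, joinEquiv X (σ, ξ) (eX i).1 = ξ i ⟨(eX i).1, rfl⟩ :=
        fun i => join_x (σ, ξ) (eX i).1 i rfl
      rw [node_prod, hs]
      simp_rw [hx]
      show (∑ l, q l (o .s) * m .s (o .s) * if σ = fun _ => (l, o0) then 1 else 0) *
        (∏ i, m (.x i) (o (.x i)) * if ξ i = fun _ => cx i (o (.x i)) then 1 else 0) *
        (∏ i, r i (o (.a i)) ((joinEquiv X (σ, ξ) (eX i).1).2 (.x i))
          (joinEquiv X (σ, ξ) (eS i).1).1) = _
      simp_rw [hes, hex]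
      rw [mul_assoc, Finset.sum_mul]
      refine Finset.sum_congr rfl fun l _ => ?_
      by_cases h1 : σ = fun _ => (l, o0)
      swap
      · simp [h1]
      congr 1
      rw [Finset.prod_mul_distrib]
      by_cases h2 : ξ = fun i _ => cx i (o (.x i))
      · subst h1 h2
        simp [cx]
      · have : ∃ i, ξ i ≠ fun _ => cx i (o (.x i)) := by
          by_contra hc
          push Not at hc
          exact h2 (funext hc)
        obtain ⟨i, hi⟩ := this
        rw [Finset.prod_eq_zero (f := fun i => if ξ i = fun _ => cx i (o (.x i)) then (1:ℝ) else 0)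
          (Finset.mem_univ i) (if_neg hi), if_neg h2]
        simp
    simp_rw [ev]
    have : ∀ σ : Out X .s, ∑ ξ : (i : Fin n) → Out X (.x i),
        ∑ l, (q l (o .s) * m .s (o .s)) * (if σ = fun _ => (l, o0) then 1 else 0) *
          ((∏ i, m (.x i) (o (.x i))) * (if ξ = fun i _ => cx i (o (.x i)) then 1 else 0) *
          ∏ i, r i (o (.a i)) (o (.x i)) l) =
        ∑ l, (q l (o .s) * m .s (o .s)) * (if σ = fun _ => (l, o0) then 1 else 0) *
          ((∏ i, m (.x i) (o (.x i))) * ∏ i, r i (o (.a i)) (o (.x i)) l) := by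
      intro σ
      rw [Finset.sum_comm]
      refine Finset.sum_congr rfl fun l _ => ?_
      rw [← Finset.mul_sum, ← Finset.sum_mul, ← Finset.mul_sum, sum_ind, mul_one]
    simp_rw [this]
    rw [Finset.sum_comm, mul_assoc, Finset.sum_mul]
    refine Finset.sum_congr rfl fun l _ => ?_
    rw [← Finset.sum_mul, ← Finset.mul_sum, sum_ind]
    ring

end BellAux

theorem statement_7 {n : ℕ} {O : BellNode n → Type}
    [∀ v, Fintype (O v)] [∀ v, Nonempty (O v)]
    (P : ((v : BellNode n) → O v) → ℝ) (hP0 : ∀ o, 0 ≤ P o) (hP1 : ∑ o, P o = 1) :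
    IsClassicalFinHV (BellEdges n) P ↔
      ∃ (Λ : Type) (iΛ : Fintype Λ) (_ : Nonempty Λ)
        (q : Λ → O BellNode.s → ℝ)
        (r : (i : Fin n) → O (BellNode.a i) → O (BellNode.x i) → Λ → ℝ),
        @IsBellLocalModel n O _ P Λ iΛ q r := by
  constructor
  · exact BellAux.forward P
  · rintro ⟨Λ, iΛ, nΛ, q, r, H⟩
    exact BellAux.backward P hP0 hP1 q r H
end

section
/- If a joint distribution P on a finite directed acyclic graph G is a classical correlation with finite hidden variables, then P admits a finite hidden-variable model in which the processing at every node with at least one incoming edge is deterministic: for every node v with in(v) ≠ ∅ and every λ ∈ ∏_{e∈in(v)} X_e, one has p_v(o, μ | λ) ∈ {0, 1} for all o ∈ O_v and μ ∈ ∏_{e∈out(v)} X_e. -/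
open Classical in
theorem hv_sum_fun {L Y : Type} [Fintype L] [Fintype Y] (q : L → Y → ℝ) :
    ∑ f : L → Y, ∏ l, q l (f l) = ∏ l, ∑ y, q l y := by
  rw [Finset.prod_univ_sum, Fintype.piFinset_univ]

open Classical in
theorem hv_sum_one {L Y : Type} [Fintype L] [Fintype Y] (q : L → Y → ℝ)
    (hq : ∀ l, ∑ y, q l y = 1) :
    ∑ f : L → Y, ∏ l, q l (f l) = 1 := by
  rw [hv_sum_fun]; simp [hq]

open Classical in
theorem hv_sum_ind {L Y : Type} [Fintype L] [Fintype Y] (q : L → Y → ℝ)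
    (hq : ∀ l, ∑ y, q l y = 1) (l0 : L) (y0 : Y) :
    ∑ f : L → Y, (if f l0 = y0 then (1:ℝ) else 0) * ∏ l, q l (f l) = q l0 y0 := by
  have h : ∀ f : L → Y, (if f l0 = y0 then (1:ℝ) else 0) * ∏ l, q l (f l)
      = ∏ l, (if l = l0 then (if f l = y0 then (1:ℝ) else 0) else 1) * q l (f l) := by
    intro f
    rw [Finset.prod_mul_distrib]
    congr 1
    rw [Finset.prod_ite_eq' Finset.univ l0 (fun l => if f l = y0 then (1:ℝ) else 0)]
    simp
  rw [Finset.sum_congr rfl (fun f _ => h f)]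
  rw [hv_sum_fun (fun l y => (if l = l0 then (if y = y0 then (1:ℝ) else 0) else 1) * q l y)]
  rw [Finset.prod_eq_single l0]
  · simp
  · intro l _ hl
    simp [hl, hq]
  · simp

/-- Splitting a tuple of pairs. -/
def hvSplit {ι : Type} (X : ι → Type) (c : ι → Prop) (R : Type) :
    (∀ i, X i × (c i → R)) ≃ (∀ i, X i) × (∀ i, c i → R) where
  toFun g := (fun i => (g i).1, fun i => (g i).2)
  invFun g := fun i => (g.1 i, g.2 i)
  left_inv _ := rfl
  right_inv _ := rfl

/-- A tuple supported at a single index. -/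
def hvOne {ι : Type} (c : ι → Prop) (R : Type) (i0 : ι) (h0 : c i0)
    (hc : ∀ i, c i → i = i0) : (∀ i, c i → R) ≃ R where
  toFun g := g i0 h0
  invFun r := fun _ _ => r
  left_inv g := by
    funext i hi
    have := hc i hi
    subst this
    rfl
  right_inv _ := rfl

theorem hv_step {V : Type} [Fintype V] [DecidableEq V] (E : Finset (V × V))
    {O : V → Type} [∀ v, Fintype (O v)]
    (P : ((v : V) → O v) → ℝ)
    (X : EdgeT E → Type) [iX : ∀ e, Fintype (X e)] (hX : ∀ e, Nonempty (X e))
    (p : (v : V) → O v → ((e : {e : EdgeT E // e.1.1 = v}) → X e.1)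
        → ((e : {e : EdgeT E // e.1.2 = v}) → X e.1) → ℝ)
    (hp : IsHVRealization E P X p) (e0 : EdgeT E) (hne : e0.1.1 ≠ e0.1.2) :
    ∃ (X' : EdgeT E → Type) (iX' : ∀ e, Fintype (X' e)) (_ : ∀ e, Nonempty (X' e))
      (p' : (v : V) → O v → ((e : {e : EdgeT E // e.1.1 = v}) → X' e.1)
          → ((e : {e : EdgeT E // e.1.2 = v}) → X' e.1) → ℝ),
      @IsHVRealization V _ _ E O _ P X' iX' p' ∧
      (∀ o μ lam, p' e0.1.2 o μ lam = 0 ∨ p' e0.1.2 o μ lam = 1) ∧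
      (∀ u, u ≠ e0.1.1 → (∀ o μ lam, p u o μ lam = 0 ∨ p u o μ lam = 1) →
        (∀ o μ lam, p' u o μ lam = 0 ∨ p' u o μ lam = 1)) := by
  classical
  obtain ⟨h0, h1, h2⟩ := hp
  let L : V → Type := fun v => (e : {e : EdgeT E // e.1.2 = v}) → X e.1
  let M : V → Type := fun v => (e : {e : EdgeT E // e.1.1 = v}) → X e.1
  let R : V → Type := fun v => L v → O v × M v
  have iR : Fintype (R e0.1.2) := by dsimp only [R, L, M]; infer_instance
  let w : R e0.1.2 → ℝ := fun f => ∏ l, p e0.1.2 (f l).1 (f l).2 l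
  have hq : ∀ u (l : L u), ∑ y : O u × M u, p u y.1 y.2 l = 1 := by
    intro u l
    rw [Fintype.sum_prod_type]
    exact h1 u l
  have hw0 : ∀ f, 0 ≤ w f := fun f => Finset.prod_nonneg fun l _ => h0 _ _ _ _
  have hw1 : ∑ f, w f = 1 :=
    (Finset.sum_congr (by congr!) (fun _ _ => rfl)).trans
    (hv_sum_one (fun (l : L e0.1.2) (y : O e0.1.2 × M e0.1.2) => p e0.1.2 y.1 y.2 l) (hq _))
  let X' : EdgeT E → Type := fun e => X e × ((e = e0) → R e0.1.2)
  let A : (u : V) → O u → M u → L u → ((h : e0.1.2 = u) → R e0.1.2) → ℝ := fun u o m l r =>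
    if h : e0.1.2 = u then (if (h ▸ r h : R u) l = (o, m) then 1 else 0) else p u o m l
  let B : (u : V) → ((h : e0.1.1 = u) → R e0.1.2) → ℝ := fun u r =>
    if h : e0.1.1 = u then w (r h) else 1
  have hA0 : ∀ u o m l r, 0 ≤ A u o m l r := by
    intro u o m l r
    dsimp only [A]
    split_ifs
    · exact zero_le_one
    · exact le_rfl
    · exact h0 _ _ _ _
  have hB0 : ∀ u r, 0 ≤ B u r := by
    intro u r
    dsimp only [B]
    split_ifs
    · exact hw0 _
    · exact zero_le_one
  have hA1 : ∀ u l r, ∑ o, ∑ m, A u o m l r = 1 := by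
    intro u l r
    dsimp only [A]
    split_ifs with h
    · rw [← Fintype.sum_prod_type']
      exact (Finset.sum_ite_eq Finset.univ _ (fun _ => (1:ℝ))).trans (by simp)
    · exact h1 u l
  let p' : (v : V) → O v → ((e : {e : EdgeT E // e.1.1 = v}) → X' e.1)
          → ((e : {e : EdgeT E // e.1.2 = v}) → X' e.1) → ℝ := fun u o m l =>
    A u o (fun e => (m e).1) (fun e => (l e).1) (fun h => (l ⟨e0, h⟩).2 rfl) *
      B u (fun h => (m ⟨e0, h⟩).2 rfl)
  refine ⟨X', fun e => (by dsimp only [X']; infer_instance), ?_, p', ⟨?_, ?_, ?_⟩, ?_, ?_⟩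
  · intro e
    have := hX e
    have : Nonempty (R e0.1.2) := by
      by_contra hcon
      rw [not_nonempty_iff] at hcon
      simp at hw1
    obtain ⟨r⟩ := this
    obtain ⟨x⟩ := hX e
    exact ⟨(x, fun _ => r)⟩
  · intro u o m l
    exact mul_nonneg (hA0 _ _ _ _ _) (hB0 _ _)
  · intro u l
    have key : ∀ o, (∑ m : (e : {e : EdgeT E // e.1.1 = u}) → X' e.1, p' u o m l)
        = ∑ m : M u, A u o m (fun e => (l e).1) (fun h => (l ⟨e0, h⟩).2 rfl) := by
      intro o
      rw [Fintype.sum_equiv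
        (hvSplit (fun e : {e : EdgeT E // e.1.1 = u} => X e.1) (fun e => e.1 = e0) (R e0.1.2))
        (fun m => p' u o m l)
        (fun mr => A u o mr.1 (fun e => (l e).1) (fun h => (l ⟨e0, h⟩).2 rfl) *
          B u (fun h => mr.2 ⟨e0, h⟩ rfl)) (fun _ => rfl)]
      rw [Fintype.sum_prod_type]
      refine Finset.sum_congr rfl fun m _ => ?_
      dsimp only
      rw [← Finset.mul_sum]
      suffices hs : ∑ r : ((i : {e : EdgeT E // e.1.1 = u}) → i.1 = e0 → R e0.1.2),
        B u (fun h => r ⟨e0, h⟩ rfl) = 1 by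
        rw [hs, mul_one]
      by_cases h : e0.1.1 = u
      · rw [Fintype.sum_equiv (hvOne (fun e : {e : EdgeT E // e.1.1 = u} => e.1 = e0) (R e0.1.2)
          ⟨e0, h⟩ rfl (fun i hi => Subtype.ext hi)) _ w ?_]
        · exact hw1
        · intro r
          dsimp only [B]
          rw [dif_pos h]
          rfl
      · have : Unique ((i : {e : EdgeT E // e.1.1 = u}) → i.1 = e0 → R e0.1.2) :=
          { default := fun i hi => absurd (hi ▸ i.2) h
            uniq := fun r => by
              funext i hi
              exact absurd (hi ▸ i.2) h }
        rw [Fintype.sum_unique]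
        dsimp only [B]
        rw [dif_neg h]
    rw [Finset.sum_congr rfl (fun o _ => key o)]
    exact hA1 _ _ _
  · intro o
    rw [h2 o]
    symm
    rw [Fintype.sum_equiv
        ((hvSplit X (fun e => e = e0) (R e0.1.2)).trans
          (Equiv.prodCongr (Equiv.refl _) (hvOne (fun e => e = e0) (R e0.1.2)
          e0 rfl (fun i hi => hi))))
        (fun lam : (e : EdgeT E) → X' e => ∏ v, p' v (o v) (fun e => lam e.1) (fun e => lam e.1))
        (fun lr : ((e : EdgeT E) → X e) × R e0.1.2 =>
          ∏ u, (A u (o u) (fun e => lr.1 e.1) (fun e => lr.1 e.1) (fun _ => lr.2) *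
          B u (fun _ => lr.2))) (fun _ => rfl)]
    rw [Fintype.sum_prod_type]
    refine Finset.sum_congr rfl fun lam _ => ?_
    dsimp only
    have hB : ∀ f : R e0.1.2, ∏ u, B u (fun _ => f) = w f := by
      intro f
      dsimp only [B]
      simp
    have hA : ∀ f : R e0.1.2, ∏ u, A u (o u) (fun e => lam e.1) (fun e => lam e.1) (fun _ => f)
        = (if f (fun e : {e : EdgeT E // e.1.2 = e0.1.2} => lam e.1) =
            (o e0.1.2, fun e : {e : EdgeT E // e.1.1 = e0.1.2} => lam e.1) then (1:ℝ) else 0) *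
          ∏ u ∈ Finset.univ.erase e0.1.2, p u (o u) (fun e => lam e.1) (fun e => lam e.1) := by
      intro f
      rw [← Finset.mul_prod_erase Finset.univ _ (Finset.mem_univ e0.1.2)]
      congr 1
      · dsimp only [A]
        rw [dif_pos rfl]
      · refine Finset.prod_congr rfl fun u hu => ?_
        dsimp only [A]
        rw [dif_neg (Finset.ne_of_mem_erase hu).symm]
    simp only [Finset.prod_mul_distrib, hA, hB]
    rw [← Finset.mul_prod_erase Finset.univ _ (Finset.mem_univ e0.1.2)]
    have := hv_sum_ind (fun (l : L e0.1.2) (y : O e0.1.2 × M e0.1.2) => p e0.1.2 y.1 y.2 l) (hq _)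
      (fun e => lam e.1) (o e0.1.2, fun e => lam e.1)
    dsimp only at this
    rw [← this, Finset.sum_mul]
    refine Finset.sum_congr (by congr!) fun f _ => ?_
    dsimp only [w]
    ring
  · intro o m l
    dsimp only [p', A, B]
    rw [dif_pos rfl, dif_neg hne, mul_one]
    split_ifs <;> simp
  · intro u hu hd o m l
    dsimp only [p', A, B]
    rw [dif_neg (Ne.symm hu), mul_one]
    split_ifs
    · simp
    · simp
    · exact hd _ _ _

theorem statement_8 {V : Type} [Fintype V] [DecidableEq V] (E : Finset (V × V))
    (hacyc : ∀ v : V, ¬ Relation.TransGen (fun u w => (u, w) ∈ E) v v)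
    {O : V → Type} [∀ v, Fintype (O v)] [∀ v, Nonempty (O v)]
    (P : ((v : V) → O v) → ℝ) (hP0 : ∀ o, 0 ≤ P o) (hP1 : ∑ o, P o = 1)
    (hcl : IsClassicalFinHV E P) :
    ∃ (X : EdgeT E → Type) (iX : ∀ e, Fintype (X e)) (_ : ∀ e, Nonempty (X e))
      (p : (v : V) → O v → ((e : {e : EdgeT E // e.1.1 = v}) → X e.1)
          → ((e : {e : EdgeT E // e.1.2 = v}) → X e.1) → ℝ),
      @IsHVRealization V _ _ E O _ P X iX p ∧
      -- determinism at every node with at least one incoming edge: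
      ∀ v : V, Nonempty {e : EdgeT E // e.1.2 = v} →
        ∀ o μ lam, p v o μ lam = 0 ∨ p v o μ lam = 1 := by
  classical
  let r : V → V → Prop := fun u w => (u, w) ∈ E
  let h : V → ℕ := fun v => (Finset.univ.filter fun u => Relation.TransGen r u v).card
  have hlt : ∀ u v, r u v → h u < h v := by
    intro u v huv
    apply Finset.card_lt_card
    rw [Finset.ssubset_iff_of_subset]
    · exact ⟨u, by simpa using Relation.TransGen.single huv, by simpa using hacyc u⟩
    · intro x hx
      simp only [Finset.mem_filter, Finset.mem_univ, true_and] at hx ⊢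
      exact hx.tail huv
  have main : ∀ S : Finset V, ∃ (X : EdgeT E → Type) (iX : ∀ e, Fintype (X e))
      (_ : ∀ e, Nonempty (X e))
      (p : (v : V) → O v → ((e : {e : EdgeT E // e.1.1 = v}) → X e.1)
          → ((e : {e : EdgeT E // e.1.2 = v}) → X e.1) → ℝ),
      @IsHVRealization V _ _ E O _ P X iX p ∧
      ∀ v ∈ S, Nonempty {e : EdgeT E // e.1.2 = v} →
        ∀ o μ lam, p v o μ lam = 0 ∨ p v o μ lam = 1 := by
    intro S
    induction S using Finset.induction_on_min_value h with
    | empty =>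
      obtain ⟨X, iX, hX, p, hp⟩ := hcl
      exact ⟨X, iX, hX, p, hp, by simp⟩
    | insert a s ha hmin ih =>
      obtain ⟨X, iX, hX, p, hp, hd⟩ := ih
      by_cases hn : Nonempty {e : EdgeT E // e.1.2 = a}
      · obtain ⟨e0, rfl⟩ := hn
        have hl := hlt e0.1.1 e0.1.2 e0.2
        obtain ⟨X', iX', hX', p', hp', hd1, hd2⟩ := hv_step E P X hX p hp e0
          (fun hh => by rw [hh] at hl; exact lt_irrefl _ hl)
        refine ⟨X', iX', hX', p', hp', ?_⟩
        intro v hv hvn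
        rcases Finset.mem_insert.1 hv with rfl | hvs
        · exact hd1
        · refine hd2 v ?_ (hd v hvs hvn)
          rintro rfl
          exact absurd (hmin _ hvs) (not_le.2 hl)
      · refine ⟨X, iX, hX, p, hp, ?_⟩
        intro v hv hvn
        rcases Finset.mem_insert.1 hv with rfl | hvs
        · exact absurd hvn hn
        · exact hd v hvs hvn
  obtain ⟨X, iX, hX, p, hp, hd⟩ := main Finset.univ
  exact ⟨X, iX, hX, p, hp, fun v => hd v (Finset.mem_univ v)⟩
end

section
/- A joint distribution P on a finite directed acyclic graph G is a classical correlation with finite hidden variables if and only if P arises from a finite hidden Bayesian network: there exist finite nonempty sets Y_v for each node v ∈ V, nonnegative numbers q_v(μ_v | μ_{pa(v)}) indexed by μ_v ∈ Y_v and tuples μ_{pa(v)} ∈ ∏_{u∈pa(v)} Y_u with ∑_{μ_v∈Y_v} q_v(μ_v | μ_{pa(v)}) = 1 for every μ_{pa(v)}, and nonnegative numbers r_v(o_v | μ_v) with ∑_{o_v∈O_v} r_v(o_v | μ_v) = 1 for every μ_v, such that for every joint outcome o: P(o) = ∑_{μ ∈ ∏_{v∈V} Y_v} (∏_{v∈V}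 r_v(o_v | μ_v)) · (∏_{v∈V} q_v(μ_v | μ|_{pa(v)})). -/
/-- The data `(Y, q, r)` is a hidden Bayesian network realizing `P`: hidden variables
`μ_v ∈ Y v` on the nodes form a Bayesian network on the graph with conditionals
`q v (μ_v | μ_{pa(v)})`, the outcomes are noisy readouts `r v (o_v | μ_v)` of the hidden
variables, and the generated joint outcome distribution is `P`. -/
def IsHBNRealization {V : Type} [Fintype V] [DecidableEq V] (E : Finset (V × V))
    {O : V → Type} [∀ v, Fintype (O v)] (P : ((v : V) → O v) → ℝ)
    (Y : V → Type) [∀ v, Fintype (Y v)]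
    (q : (v : V) → Y v → ((u : {u : V // (u, v) ∈ E}) → Y u.1) → ℝ)
    (r : (v : V) → O v → Y v → ℝ) : Prop :=
  (∀ v μv μpa, 0 ≤ q v μv μpa) ∧
  (∀ (v : V) (μpa : (u : {u : V // (u, v) ∈ E}) → Y u.1), ∑ μv : Y v, q v μv μpa = 1) ∧
  (∀ v ov μv, 0 ≤ r v ov μv) ∧
  (∀ (v : V) (μv : Y v), ∑ ov : O v, r v ov μv = 1) ∧
  (∀ o : (v : V) → O v,
    P o = ∑ μ : (v : V) → Y v,
      (∏ v, r v (o v) (μ v)) * ∏ v, q v (μ v) (fun u => μ u.1))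

/-- Reshuffling node data (outcome, outgoing edge labels) into outcomes and edge labels. -/
def nodeEdgeEquiv {V : Type} (E : Finset (V × V)) (O : V → Type) (X : EdgeT E → Type) :
    ((v : V) → O v × ((e : {e : EdgeT E // e.1.1 = v}) → X e.1)) ≃
      ((v : V) → O v) × ((e : EdgeT E) → X e) where
  toFun μ := (fun v => (μ v).1, fun e => (μ e.1.1).2 ⟨e, rfl⟩)
  invFun a := fun v => (a.1 v, fun e => a.2 e.1)
  left_inv μ := by
    funext v
    refine Prod.ext rfl ?_
    funext ⟨e, he⟩
    subst he
    rfl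
  right_inv a := rfl

theorem mem_of_target {V : Type} (E : Finset (V × V)) {v : V}
    (e : {e : EdgeT E // e.1.2 = v}) : (e.1.1.1, v) ∈ E := by
  obtain ⟨e, rfl⟩ := e
  exact e.2

theorem hv_to_hbn {V : Type} [Fintype V] [DecidableEq V] (E : Finset (V × V))
    {O : V → Type} [∀ v, Fintype (O v)] [∀ v, Nonempty (O v)]
    (P : ((v : V) → O v) → ℝ) (h : IsClassicalFinHV E P) :
      ∃ (Y : V → Type) (iY : ∀ v, Fintype (Y v)) (_ : ∀ v, Nonempty (Y v))
        (q : (v : V) → Y v → ((u : {u : V // (u, v) ∈ E}) → Y u.1) → ℝ)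
        (r : (v : V) → O v → Y v → ℝ),
        @IsHBNRealization V _ _ E O _ P Y iY q r := by
  classical
  obtain ⟨X, iX, nX, p, h0, h1, hP⟩ := h
  refine ⟨fun v => O v × ((e : {e : EdgeT E // e.1.1 = v}) → X e.1), fun v => inferInstance,
    fun v => inferInstance,
    fun v y pa => p v y.1 y.2 (fun e => (pa ⟨e.1.1.1, mem_of_target E e⟩).2 ⟨e.1, rfl⟩),
    fun v o y => if o = y.1 then 1 else 0, ?_, ?_, ?_, ?_, ?_⟩
  · intro v a b
    exact h0 _ _ _ _
  · intro v pa
    rw [Fintype.sum_prod_type]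
    exact h1 v _
  · intro v o y
    positivity
  · intro v y
    simp
  · intro o
    rw [hP]
    symm
    rw [← (nodeEdgeEquiv E O X).symm.sum_comp, Fintype.sum_prod_type,
      Finset.sum_eq_single o]
    · apply Finset.sum_congr rfl
      intro lam _
      simp [nodeEdgeEquiv]
    · intro o' _ hne
      apply Finset.sum_eq_zero
      intro lam _
      obtain ⟨v, hv⟩ := Function.ne_iff.mp hne
      rw [Finset.prod_eq_zero (Finset.mem_univ v), zero_mul]
      exact if_neg (fun h => hv h.symm)
    · simp

theorem hbn_to_hv {V : Type} [Fintype V] [DecidableEq V] (E : Finset (V × V))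
    {O : V → Type} [∀ v, Fintype (O v)]
    (P : ((v : V) → O v) → ℝ)
    (Y : V → Type) [iY : ∀ v, Fintype (Y v)] (nY : ∀ v, Nonempty (Y v))
    (q : (v : V) → Y v → ((u : {u : V // (u, v) ∈ E}) → Y u.1) → ℝ)
    (r : (v : V) → O v → Y v → ℝ)
    (h : IsHBNRealization E P Y q r) : IsClassicalFinHV E P := by
  classical
  obtain ⟨q0, q1, r0, r1, hP⟩ := h
  refine ⟨fun e => Y e.1.1, fun e => iY _, fun e => nY _,
    fun v o μ lam => ∑ y : Y v, q v y (fun u => lam ⟨⟨(u.1, v), u.2⟩, rfl⟩) * r v o y *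
      (if μ = (fun e => cast (congrArg Y e.2.symm) y) then 1 else 0), ?_, ?_, ?_⟩
  · intro v o μ lam
    refine Finset.sum_nonneg fun y _ => mul_nonneg (mul_nonneg (q0 _ _ _) (r0 _ _ _)) ?_
    positivity
  · intro v lam
    have : ∀ o : O v, (∑ μ : (e : {e : EdgeT E // e.1.1 = v}) → Y e.1.1.1,
        ∑ y : Y v, q v y (fun u => lam ⟨⟨(u.1, v), u.2⟩, rfl⟩) * r v o y *
          (if μ = (fun e => cast (congrArg Y e.2.symm) y) then (1:ℝ) else 0)) =
        ∑ y : Y v, q v y (fun u => lam ⟨⟨(u.1, v), u.2⟩, rfl⟩) * r v o y := by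
      intro o
      rw [Finset.sum_comm]
      simp
    simp only [this]
    rw [Finset.sum_comm]
    simp only [← Finset.mul_sum, r1, mul_one]
    exact q1 v _
  · intro o
    rw [hP]
    simp only [Finset.prod_univ_sum, Fintype.piFinset_univ]
    rw [Finset.sum_comm]
    apply Finset.sum_congr rfl
    intro y _
    rw [Finset.sum_eq_single (fun e : EdgeT E => y e.1.1)]
    · rw [← Finset.prod_mul_distrib]
      apply Finset.prod_congr rfl
      intro v _
      rw [if_pos]
      · ring
      · funext ⟨e, he⟩
        subst he
        rfl
    · intro lam _ hne
      obtain ⟨e, he⟩ := Function.ne_iff.mp hne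
      apply Finset.prod_eq_zero (Finset.mem_univ e.1.1)
      rw [if_neg, mul_zero]
      intro h
      exact he (congrFun h ⟨e, rfl⟩)
    · simp

theorem statement_9 {V : Type} [Fintype V] [DecidableEq V] (E : Finset (V × V))
    (hacyc : ∀ v : V, ¬ Relation.TransGen (fun u w => (u, w) ∈ E) v v)
    {O : V → Type} [∀ v, Fintype (O v)] [∀ v, Nonempty (O v)]
    (P : ((v : V) → O v) → ℝ) (hP0 : ∀ o, 0 ≤ P o) (hP1 : ∑ o, P o = 1) :
    IsClassicalFinHV E P ↔
      ∃ (Y : V → Type) (iY : ∀ v, Fintype (Y v)) (_ : ∀ v, Nonempty (Y v))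
        (q : (v : V) → Y v → ((u : {u : V // (u, v) ∈ E}) → Y u.1) → ℝ)
        (r : (v : V) → O v → Y v → ℝ),
        @IsHBNRealization V _ _ E O _ P Y iY q r := by
  exact ⟨hv_to_hbn E P, fun ⟨Y, _, nY, q, r, h⟩ => hbn_to_hv E P Y nY q r h⟩
end

section
/- Let G = (V,E) and G' = (V,E') be two finite directed acyclic graphs on the same node set V with the same outcome sets O_v, and suppose they induce the same reachability relation: for all u, v ∈ V, there is a nonempty directed path from u to v in G if and only if there is one in G'. Then a joint distribution P on ∏_{v∈V} O_v is a classical correlation with finite hidden variables on G if and only if it is a classical correlation with finite hidden variables on G'. -/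
/-- Canonical form: one hidden variable per node, depending only on the strict past. -/
def CanonHV {V : Type} [Fintype V] [DecidableEq V] (R : V → V → Prop)
    {O : V → Type} [∀ v, Fintype (O v)] (P : ((v : V) → O v) → ℝ) : Prop :=
  ∃ (Y : V → Type) (_ : ∀ v, Fintype (Y v)) (_ : ∀ v, Nonempty (Y v))
    (k : (v : V) → O v → Y v → ((a : V) → Y a) → ℝ),
    (∀ v o y z, 0 ≤ k v o y z) ∧
    (∀ v z, ∑ o : O v, ∑ y : Y v, k v o y z = 1) ∧
    (∀ v o y z z', (∀ a, R a v → z a = z' a) → k v o y z = k v o y z') ∧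
    (∀ o : (v : V) → O v, P o = ∑ y : (v : V) → Y v, ∏ v, k v (o v) (y v) y)

theorem canon_of_classical {V : Type} [Fintype V] [DecidableEq V] (E : Finset (V × V))
    {O : V → Type} [∀ v, Fintype (O v)] (P : ((v : V) → O v) → ℝ)
    (h : IsClassicalFinHV E P) :
    CanonHV (Relation.TransGen (fun a b => (a, b) ∈ E)) P := by
  obtain ⟨X, iX, nX, p, h0, h1, h2⟩ := h
  let eqv : ((e : EdgeT E) → X e) ≃ ((v : V) → (e : {e : EdgeT E // e.1.1 = v}) → X e.1) :=
    { toFun := fun lam v e => lam e.1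
      invFun := fun y e => y e.1.1 ⟨e, rfl⟩
      left_inv := fun lam => rfl
      right_inv := by
        intro y
        funext v e
        obtain ⟨e, rfl⟩ := e
        rfl }
  refine ⟨fun v => (e : {e : EdgeT E // e.1.1 = v}) → X e.1, fun v => inferInstance,
    fun v => inferInstance,
    fun v o y z => p v o y (fun e => z e.1.1.1 ⟨e.1, rfl⟩), ?_, ?_, ?_, ?_⟩
  · intro v o y z; exact h0 _ _ _ _
  · intro v z; exact h1 _ _
  · intro v o y z z' hz
    have : (fun e : {e : EdgeT E // e.1.2 = v} => z e.1.1.1 ⟨e.1, rfl⟩)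
        = (fun e : {e : EdgeT E // e.1.2 = v} => z' e.1.1.1 ⟨e.1, rfl⟩) := by
      funext e
      obtain ⟨⟨⟨a, b⟩, he⟩, rfl⟩ := e
      rw [hz a (Relation.TransGen.single he)]
    simp only [this]
  · intro o
    rw [h2 o]
    exact Fintype.sum_equiv eqv _ _ (fun lam => rfl)

open Classical in
theorem classical_of_canon {V : Type} [Fintype V] [DecidableEq V] (E : Finset (V × V))
    (hacyc : ∀ v : V, ¬ Relation.TransGen (fun u w => (u, w) ∈ E) v v)
    {O : V → Type} [∀ v, Fintype (O v)] (P : ((v : V) → O v) → ℝ)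
    (h : CanonHV (Relation.TransGen (fun a b => (a, b) ∈ E)) P) :
    IsClassicalFinHV E P := by
  obtain ⟨Y, iY, nY, k, h0, h1, hk, h2⟩ := h
  set R : V → V → Prop := Relation.TransGen (fun a b => (a, b) ∈ E) with hR
  have hRt : ∀ {a b c}, R a b → R b c → R a c := fun h h' => Relation.TransGen.trans h h'
  have hg : ∀ v a, R a v → ∃ e : {e : EdgeT E // e.1.2 = v}, a = e.1.1.1 ∨ R a e.1.1.1 := by
    intro v a hav
    cases hav with
    | single he => exact ⟨⟨⟨(a, v), he⟩, rfl⟩, Or.inl rfl⟩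
    | @tail b _ hab hb => exact ⟨⟨⟨(b, v), hb⟩, rfl⟩, Or.inr hab⟩
  choose g hg using hg
  have hgen : ∀ v (e : {e : EdgeT E // e.1.2 = v}), R e.1.1.1 v := by
    rintro v ⟨⟨⟨a, b⟩, he⟩, rfl⟩
    exact Relation.TransGen.single he
  let d : (v : V) → Y v := fun v => Classical.arbitrary _
  let asm : (v : V) → ((e : {e : EdgeT E // e.1.2 = v}) → ((a : V) → Y a)) → (a : V) → Y a :=
    fun v lam a => if h : R a v then lam (g v a h) a else d a
  let L : ((a : V) → Y a) → EdgeT E → (a : V) → Y a :=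
    fun y e a => if a = e.1.1 ∨ R a e.1.1 then y a else d a
  have hasm : ∀ y v a, asm v (fun e => L y e.1) a = if R a v then y a else d a := by
    intro y v a
    by_cases hav : R a v
    · simp only [asm, L, hav, dif_pos, if_pos, hg v a hav]
    · simp only [asm, hav, dif_neg, if_neg, not_false_eq_true]
  have hupd : ∀ y (e : EdgeT E),
      Function.update (asm e.1.1 (fun e' => L y e'.1)) e.1.1 (y e.1.1) = L y e := by
    intro y e
    funext a
    by_cases ha : a = e.1.1
    · obtain ⟨⟨s, t⟩, he⟩ := e
      simp only at ha
      subst ha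
      simp [L]
    · rw [Function.update_of_ne ha, hasm]
      simp [L, ha]
  have hwf : WellFounded R := by
    have : IsTrans V R := ⟨fun _ _ _ => hRt⟩
    have : Std.Irrefl R := ⟨hacyc⟩
    exact Finite.wellFounded_of_trans_of_irrefl R
  have huniq : ∀ y (lam : EdgeT E → (a : V) → Y a),
      (∀ v, ∀ e : {e : EdgeT E // e.1.1 = v}, lam e.1 =
        Function.update (asm v (fun e' => lam e'.1)) v (y v)) → lam = L y := by
    intro y lam hl
    have key : ∀ v, ∀ e : EdgeT E, e.1.1 = v → lam e = L y e := by
      intro v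
      induction v using hwf.induction with
      | _ v ih =>
        intro e he
        subst he
        rw [hl e.1.1 ⟨e, rfl⟩, ← hupd y e]
        congr 1
        funext a
        by_cases hav : R a e.1.1
        · have hedge : R (g e.1.1 a hav).1.1.1 e.1.1 := hgen _ _
          simp only [asm, hav, dif_pos]
          rw [ih _ hedge _ rfl]
        · simp only [asm, hav, dif_neg, not_false_eq_true]
    funext e
    exact key _ e rfl
  refine ⟨fun _ => (a : V) → Y a, fun _ => inferInstance, fun _ => inferInstance,
    fun v o μ lam => ∑ y : Y v, k v o y (asm v lam) *
      (if μ = (fun _ => Function.update (asm v lam) v y) then 1 else 0), ?_, ?_, ?_⟩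
  · intro v o μ lam
    refine Finset.sum_nonneg fun y _ => mul_nonneg (h0 _ _ _ _) ?_
    split_ifs <;> norm_num
  · intro v lam
    refine Eq.trans ?_ (h1 v (asm v lam))
    refine Finset.sum_congr rfl fun o _ => ?_
    rw [Finset.sum_comm]
    refine Finset.sum_congr rfl fun y _ => ?_
    rw [← Finset.mul_sum]
    simp
  · intro o
    rw [h2 o]
    simp only [Fintype.prod_sum]
    rw [Finset.sum_comm]
    refine Finset.sum_congr rfl fun y _ => ?_
    simp only [Finset.prod_mul_distrib]
    rw [Finset.sum_eq_single (L y)]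
    · have e1 : ∀ v, k v (o v) (y v) (asm v (fun e => L y e.1)) = k v (o v) (y v) y := by
        intro v
        apply hk
        intro a ha
        rw [hasm, if_pos ha]
      have e2 : ∀ v, (fun e : {e : EdgeT E // e.1.1 = v} => L y e.1) =
          (fun _ => Function.update (asm v (fun e => L y e.1)) v (y v)) := by
        intro v
        funext e
        obtain ⟨e, rfl⟩ := e
        exact (hupd y e).symm
      rw [Finset.prod_congr rfl (fun v _ => e1 v),
        Finset.prod_congr rfl (fun v _ => if_pos (e2 v))]
      simp
    · intro lam _ hne
      apply mul_eq_zero_of_right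
      by_contra hprod
      replace hprod := Finset.prod_ne_zero_iff.mp hprod
      apply hne
      apply huniq
      intro v e
      have := hprod v (Finset.mem_univ _)
      have h3 := (ite_ne_right_iff.mp this).1
      exact congrFun h3 e
    · intro h; exact absurd (Finset.mem_univ _) h

theorem statement_10 {V : Type} [Fintype V] [DecidableEq V]
    (E E' : Finset (V × V))
    (hacyc : ∀ v : V, ¬ Relation.TransGen (fun u w => (u, w) ∈ E) v v)
    (hacyc' : ∀ v : V, ¬ Relation.TransGen (fun u w => (u, w) ∈ E') v v)
    (hreach : ∀ u v : V,
      Relation.TransGen (fun a b => (a, b) ∈ E) u v ↔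
      Relation.TransGen (fun a b => (a, b) ∈ E') u v)
    {O : V → Type} [∀ v, Fintype (O v)] [∀ v, Nonempty (O v)]
    (P : ((v : V) → O v) → ℝ) (hP0 : ∀ o, 0 ≤ P o) (hP1 : ∑ o, P o = 1) :
    IsClassicalFinHV E P ↔ IsClassicalFinHV E' P := by
  have hR : Relation.TransGen (fun a b => (a, b) ∈ E) =
      Relation.TransGen (fun a b => (a, b) ∈ E') := by
    funext u v
    exact propext (hreach u v)
  constructor
  · intro h
    apply classical_of_canon E' hacyc'
    rw [← hR]
    exact canon_of_classical E P h
  · intro h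
    apply classical_of_canon E hacyc
    rw [hR]
    exact canon_of_classical E' P h
end

section
/- Let n ≥ 1, let (X_k, Σ_k) for k = 1, …, n be measurable spaces, let P be a probability measure on the product X_1 × … × X_n equipped with the product σ-algebra Σ_1 ⊗ … ⊗ Σ_n, let S be a finite nonempty set, let f : X_1 × … × X_n → S be measurable (S carrying the discrete σ-algebra), and let ε > 0. Then there exist finite nonempty sets S_k, measurable functions f_k : X_k → S_k (each S_k carrying the discrete σ-algebra), and a function g : S_1 × … × S_n → S such that P({x ∈ X_1 × … × X_n : f(x) ≠ g(f_1(x_1), …, f_n(x_n))}) < ε. -/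
open MeasureTheory

/-- Sets determined by finitely-valued measurable functions of the coordinates. -/
def FinCyl {n : ℕ} (Xs : Fin n → Type*) [∀ k, MeasurableSpace (Xs k)] :
    Set (Set ((k : Fin n) → Xs k)) :=
  {A | ∃ (Sk : Fin n → Type) (_ : ∀ k, Finite (Sk k)) (_ : ∀ k, Nonempty (Sk k))
      (fk : (k : Fin n) → Xs k → Sk k),
      (∀ (k : Fin n) (t : Sk k), MeasurableSet (fk k ⁻¹' {t})) ∧
      ∃ T : Set ((k : Fin n) → Sk k), A = {x | (fun k => fk k (x k)) ∈ T}}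

theorem finCyl_isSetAlgebra {n : ℕ} (Xs : Fin n → Type*) [∀ k, MeasurableSpace (Xs k)] :
    IsSetAlgebra (FinCyl Xs) where
  empty_mem := ⟨fun _ => Unit, fun _ => inferInstance, fun _ => inferInstance, fun _ _ => (),
    fun _ _ => measurable_const (measurableSet_singleton _), ∅, by ext; simp⟩
  compl_mem := by
    rintro A ⟨Sk, h1, h2, fk, hm, T, rfl⟩
    exact ⟨Sk, h1, h2, fk, hm, Tᶜ, rfl⟩
  union_mem := by
    rintro A B ⟨Sk, h1, h2, fk, hm, T, rfl⟩ ⟨Sk', h1', h2', fk', hm', T', rfl⟩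
    refine ⟨fun k => Sk k × Sk' k, fun _ => inferInstance, fun _ => inferInstance,
      fun k x => (fk k x, fk' k x), ?_, 
      {y | (fun k => (y k).1) ∈ T ∨ (fun k => (y k).2) ∈ T'}, rfl⟩
    rintro k ⟨t, t'⟩
    convert (hm k t).inter (hm' k t') using 1
    ext x; simp

theorem finCyl_measurable {n : ℕ} (Xs : Fin n → Type*) [∀ k, MeasurableSpace (Xs k)]
    {A} (hA : A ∈ FinCyl Xs) : MeasurableSet A := by
  obtain ⟨Sk, h1, h2, fk, hm, T, rfl⟩ := hA
  have : {x : (k : Fin n) → Xs k | (fun k => fk k (x k)) ∈ T}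
      = ⋃ t ∈ T, ⋂ k, (fun x => x k) ⁻¹' (fk k ⁻¹' {t k}) := by
    ext x
    simp only [Set.mem_setOf_eq, Set.mem_iUnion, Set.mem_iInter, Set.mem_preimage,
      Set.mem_singleton_iff, exists_prop]
    constructor
    · intro h; exact ⟨_, h, fun _ => rfl⟩
    · rintro ⟨t, ht, h⟩
      rwa [show (fun k => fk k (x k)) = t from funext h]
  rw [this]
  exact MeasurableSet.biUnion (Set.to_countable T) fun t _ =>
    MeasurableSet.iInter fun k => measurable_pi_apply k (hm k (t k))

theorem finCyl_generateFrom {n : ℕ} (Xs : Fin n → Type*) [∀ k, MeasurableSpace (Xs k)] :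
    (MeasurableSpace.pi : MeasurableSpace ((k : Fin n) → Xs k))
      = MeasurableSpace.generateFrom (FinCyl Xs) := by
  apply le_antisymm
  · refine iSup_le fun k => ?_
    rintro _ ⟨B, hB, rfl⟩
    apply MeasurableSpace.measurableSet_generateFrom
    classical
    refine ⟨fun _ => Prop, fun _ => inferInstance, fun _ => inferInstance,
      fun j x => ∃ h : j = k, (h ▸ x) ∈ B, ?_, {y | y k}, ?_⟩
    · intro j t
      by_cases h : j = k
      · subst h
        by_cases ht : t
        · convert hB using 1
          ext x; simp [ht]
        · convert hB.compl using 1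
          ext x; simp [ht]
      · have : (fun x : Xs j => ∃ h : j = k, (h ▸ x) ∈ B) = fun _ => False := by
          ext x; simp [h]
        beta_reduce; rw [this]
        exact MeasurableSet.preimage (MeasurableSpace.measurableSet_top) measurable_const
    · ext x; simp
  · exact MeasurableSpace.generateFrom_le fun A hA => finCyl_measurable Xs hA

theorem statement_14 {n : ℕ} (hn : 1 ≤ n) (Xs : Fin n → Type*)
    [∀ k, MeasurableSpace (Xs k)]
    (P : Measure ((k : Fin n) → Xs k)) [IsProbabilityMeasure P]
    {S : Type*} [Finite S] [Nonempty S]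
    (f : ((k : Fin n) → Xs k) → S) (hf : ∀ s : S, MeasurableSet (f ⁻¹' {s}))
    (ε : ℝ) (hε : 0 < ε) :
    ∃ (Sk : Fin n → Type) (_ : ∀ k, Finite (Sk k)) (_ : ∀ k, Nonempty (Sk k))
      (fk : (k : Fin n) → Xs k → Sk k),
      (∀ (k : Fin n) (t : Sk k), MeasurableSet (fk k ⁻¹' {t})) ∧
      ∃ g : ((k : Fin n) → Sk k) → S,
        P {x | f x ≠ g (fun k => fk k (x k))} < ENNReal.ofReal ε := by
  classical
  obtain ⟨m, ⟨e⟩⟩ := Finite.exists_equiv_fin S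
  have hδ : 0 < ENNReal.ofReal (ε / (m + 1)) := ENNReal.ofReal_pos.2 (by positivity)
  have key : ∀ i : Fin m, ∃ A ∈ FinCyl Xs,
      P (symmDiff A (f ⁻¹' {e.symm i})) < ENNReal.ofReal (ε / (m + 1)) := fun i =>
    exists_measure_symmDiff_lt_of_generateFrom_isSetRing (finCyl_isSetAlgebra Xs).isSetRing
      ⟨{Set.univ}, Set.countable_singleton _,
        by simpa using (finCyl_isSetAlgebra Xs).univ_mem, by simp⟩
      (finCyl_generateFrom Xs) (hf _) hδ
  choose A hA hPA using key
  choose Sk h1 h2 fk hm T hT using hA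
  refine ⟨fun k => ∀ i, Sk i k, fun k => inferInstance, fun k => inferInstance,
    fun k x i => fk i k x, ?_, fun y => if h : ∃ i, (fun k => y k i) ∈ T i then e.symm h.choose
      else Classical.arbitrary S, ?_⟩
  · intro k t
    convert MeasurableSet.iInter fun i => hm i k (t i) using 1
    ext x; simp [funext_iff]
  · have hsub : {x | f x ≠ (fun y : ∀ k, ∀ i, Sk i k => 
        if h : ∃ i, (fun k => y k i) ∈ T i then e.symm h.choose
        else Classical.arbitrary S) (fun k i => fk i k (x k))} ⊆
        ⋃ i, symmDiff (A i) (f ⁻¹' {e.symm i}) := by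
      intro x hx
      by_contra hcon
      apply hx
      have hiff : ∀ i, (fun k => fk i k (x k)) ∈ T i ↔ f x = e.symm i := by
        intro i
        have h3 : x ∉ symmDiff (A i) (f ⁻¹' {e.symm i}) := fun h => hcon (Set.mem_iUnion.2 ⟨i, h⟩)
        have h4 : x ∈ A i ↔ (fun k => fk i k (x k)) ∈ T i := by
          conv_lhs => rw [hT i]
          rfl
        rw [← h4]
        simp only [Set.mem_symmDiff, Set.mem_preimage, Set.mem_singleton_iff] at h3
        tauto
      have hex : ∃ i, (fun k => fk i k (x k)) ∈ T i := ⟨e (f x), (hiff _).2 (by simp)⟩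
      simp only [dif_pos hex]
      exact (hiff _).1 hex.choose_spec
    calc _ ≤ P (⋃ i, symmDiff (A i) (f ⁻¹' {e.symm i})) := measure_mono hsub
      _ ≤ ∑ i, P (symmDiff (A i) (f ⁻¹' {e.symm i})) := measure_iUnion_fintype_le _ _
      _ ≤ ∑ i : Fin m, ENNReal.ofReal (ε / (m + 1)) := Finset.sum_le_sum fun i _ => (hPA i).le
      _ = ENNReal.ofReal (m * (ε / (m + 1))) := by
        rw [ENNReal.ofReal_mul (by positivity)]; simp
      _ < ENNReal.ofReal ε := by
        rw [ENNReal.ofReal_lt_ofReal_iff hε, ← mul_div_assoc, div_lt_iff₀ (by positivity)]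
        nlinarith
end
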